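/- arXiv:2208.10667 — 3 statements merged into one kernel-verified Lean document; each statement's English description precedes it below -/
import Mathlib

section
/- Let D be a Borel data structure over ℕ and X = (X_a)_{a ⊆ ℕ finite} an exchangeable D-measurement, viewed as a random variable in the projective limit D_ℕ equipped with the action of finite permutations of ℕ. Then the following are equivalent: (i) X is ergodic, i.e. ℙ[X ∈ M] ∈ {0,1} for every measurable M ⊆ D_ℕ with D[π](M) = M for all finite permutations π of ℕ; (ii) X has the independence property: X_a and X_b are stochastically independent for all finite a, b ⊆ ℕ with a ∩ b = ∅; (iii) for every countable set 𝒢 of bounded measurable functions, each g ∈ 𝒢 defined on some D_{[k]}, there exists a deterministic sequence (x_n) with x_n ∈ D_{[m_n]}, m_n → ∞, such that for every g ∈ 𝒢 defined on D_{[k]} one has E[g(X_{[k]})] = lim_{n→∞} avg(g,m_n)(x_n). -/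
open MeasureTheory ProbabilityTheory

/-- A Borel data structure over `ℕ`: for every finite set `a ⊆ ℕ` a standard Borel
space `obj a`, and contravariantly for every injection `τ : b → a` of finite subsets
of `ℕ` a measurable restriction map `map τ : obj a → obj b`, functorially. -/
structure BDS where
  obj : Finset ℕ → Type
  mss : ∀ a : Finset ℕ, MeasurableSpace (obj a)
  sbs : ∀ a : Finset ℕ, @StandardBorelSpace (obj a) (mss a)
  map : ∀ {b a : Finset ℕ}, (↥b ↪ ↥a) → obj a → obj b
  map_id : ∀ a : Finset ℕ, map (Function.Embedding.refl ↥a) = id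
  map_comp : ∀ {c b a : Finset ℕ} (σ : ↥c ↪ ↥b) (τ : ↥b ↪ ↥a),
    map (σ.trans τ) = map σ ∘ map τ
  map_measurable : ∀ {b a : Finset ℕ} (τ : ↥b ↪ ↥a),
    @Measurable _ _ (mss a) (mss b) (map τ)

attribute [instance] BDS.mss BDS.sbs

/-- The inclusion embedding `↥b ↪ ↥a` associated to `b ⊆ a`. -/
def inclEmb {b a : Finset ℕ} (h : b ⊆ a) : ↥b ↪ ↥a :=
  ⟨fun i => ⟨i.1, h i.2⟩, fun i j hij => by
    rcases i with ⟨i, hi⟩; rcases j with ⟨j, hj⟩; simpa using hij⟩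

/-- An exchangeable law on a Borel data structure: a probability measure on each
`obj a`, compatible with all restriction maps. -/
structure ExchLaw (D : BDS) where
  law : ∀ a : Finset ℕ, Measure (D.obj a)
  prob : ∀ a : Finset ℕ, IsProbabilityMeasure (law a)
  exch : ∀ {b a : Finset ℕ} (τ : ↥b ↪ ↥a), Measure.map (D.map τ) (law a) = law b

/-- A (true) natural transformation of Borel data structures. -/
structure NT (D E : BDS) where
  app : ∀ a : Finset ℕ, D.obj a → E.obj a
  meas : ∀ a : Finset ℕ, Measurable (app a)
  natural : ∀ {b a : Finset ℕ} (τ : ↥b ↪ ↥a) (x : D.obj a),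
    app b (D.map τ x) = E.map τ (app a x)

/-- A `ν`-almost-sure natural transformation of Borel data structures. -/
structure ASNatTrans (D E : BDS) (ν : ∀ a : Finset ℕ, Measure (D.obj a)) where
  app : ∀ a : Finset ℕ, D.obj a → E.obj a
  meas : ∀ a : Finset ℕ, Measurable (app a)
  natural : ∀ {b a : Finset ℕ} (τ : ↥b ↪ ↥a),
    ∀ᵐ x ∂(ν a), app b (D.map τ x) = E.map τ (app a x)
/-- The projective limit `D_ℕ`: the sampling-consistent families in `∏_a D_a`. -/
def limitSet (D : BDS) : Set (∀ a : Finset ℕ, D.obj a) :=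
  {x | ∀ ⦃b a : Finset ℕ⦄ (h : b ⊆ a), D.map (inclEmb h) (x a) = x b}

/-- The embedding `↥b ↪ ↥(π(b))` induced by a permutation `π` of `ℕ`. -/
def permEmb (π : Equiv.Perm ℕ) (b : Finset ℕ) : ↥b ↪ ↥(b.image ⇑π) :=
  ⟨fun i => ⟨π i, Finset.mem_image_of_mem _ i.2⟩, fun i j h => by
    apply Subtype.ext
    exact π.injective (congrArg Subtype.val h)⟩

/-- The action of a permutation `π` of `ℕ` on families `(x_a)_a`:
`(π • x)_b = D[π̂_b](x_{π(b)})`. -/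
def permAct (D : BDS) (π : Equiv.Perm ℕ) (x : ∀ a : Finset ℕ, D.obj a) :
    ∀ a : Finset ℕ, D.obj a :=
  fun b => D.map (permEmb π b) (x (b.image ⇑π))

/-- The empirical average `avg(g,n)` of a kernel `g : D_{[k]} → ℝ` over all
injections `[k] ↪ [n]`. -/
noncomputable def avg (D : BDS) (k : ℕ) (g : D.obj (Finset.range k) → ℝ) (n : ℕ)
    (x : D.obj (Finset.range n)) : ℝ :=
  ((Nat.factorial (n - k) : ℝ) / (Nat.factorial n : ℝ)) *
    ∑ τ : (↥(Finset.range k) ↪ ↥(Finset.range n)), g (D.map τ x)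

/-- Any two embeddings into a finite type differ by a permutation. -/
lemma exists_perm_trans_eq {α V : Type*} [Finite V] (e τ : α ↪ V) :
    ∃ π : Equiv.Perm V, e.trans π.toEmbedding = τ := by
  classical
  let q : Set.range e ≃ Set.range τ :=
    (Equiv.ofInjective e e.injective).symm.trans (Equiv.ofInjective τ τ.injective)
  refine ⟨q.extendSubtype, ?_⟩
  ext i
  have h := Equiv.extendSubtype_apply_of_mem q (e i) ⟨i, rfl⟩
  have h2 : (⟨e i, ⟨i, rfl⟩⟩ : Set.range e) = Equiv.ofInjective e e.injective i := rfl
  simp only [Function.Embedding.trans_apply, Equiv.coe_toEmbedding]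
  rw [h, h2]
  simp [q]

/-- The average of a function over all permutations of a finite type. -/
noncomputable def permMean {V : Type*} [Fintype V] [DecidableEq V]
    (φ : Equiv.Perm V → ℝ) : ℝ :=
  (Fintype.card (Equiv.Perm V) : ℝ)⁻¹ * ∑ π, φ π

section PermMean

open Finset

variable {V : Type*} [Fintype V] [DecidableEq V]

lemma permMean_const (r : ℝ) : permMean (fun _ : Equiv.Perm V => r) = r := by
  have : (Fintype.card (Equiv.Perm V) : ℝ) ≠ 0 := by
    exact_mod_cast Fintype.card_ne_zero
  simp only [permMean, sum_const, card_univ, nsmul_eq_mul]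
  field_simp

lemma permMean_mul_right (θ : Equiv.Perm V) (φ : Equiv.Perm V → ℝ) :
    permMean (fun π => φ (π * θ)) = permMean φ := by
  unfold permMean
  congr 1
  exact Equiv.sum_comp (Equiv.mulRight θ) φ

lemma permMean_mul_left (θ : Equiv.Perm V) (φ : Equiv.Perm V → ℝ) :
    permMean (fun π => φ (θ * π)) = permMean φ := by
  unfold permMean
  congr 1
  exact Equiv.sum_comp (Equiv.mulLeft θ) φ

lemma permMean_sub (φ ψ : Equiv.Perm V → ℝ) :
    permMean (fun π => φ π - ψ π) = permMean φ - permMean ψ := by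
  simp [permMean, sum_sub_distrib, mul_sub]

lemma permMean_const_mul (r : ℝ) (φ : Equiv.Perm V → ℝ) :
    permMean (fun π => r * φ π) = r * permMean φ := by
  simp only [permMean, ← mul_sum]; ring

lemma permMean_sum {ι : Type*} (s : Finset ι) (φ : ι → Equiv.Perm V → ℝ) :
    permMean (fun π => ∑ i ∈ s, φ i π) = ∑ i ∈ s, permMean (φ i) := by
  simp only [permMean]
  rw [sum_comm, mul_sum]

lemma permMean_mono {φ ψ : Equiv.Perm V → ℝ} (h : ∀ π, φ π ≤ ψ π) :
    permMean φ ≤ permMean ψ :=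
  mul_le_mul_of_nonneg_left (sum_le_sum fun π _ => h π) (by positivity)

lemma abs_permMean_le (φ : Equiv.Perm V → ℝ) :
    |permMean φ| ≤ permMean fun π => |φ π| := by
  unfold permMean
  rw [abs_mul, abs_of_nonneg (by positivity)]
  exact mul_le_mul_of_nonneg_left (abs_sum_le_sum_abs _ _) (by positivity)

lemma abs_permMean_le_of_forall {φ : Equiv.Perm V → ℝ} {C : ℝ} (h : ∀ π, |φ π| ≤ C) :
    |permMean φ| ≤ C :=
  (abs_permMean_le φ).trans ((permMean_mono h).trans_eq (permMean_const C))

lemma permMean_comm (φ : Equiv.Perm V → Equiv.Perm V → ℝ) :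
    permMean (fun π => permMean fun ρ => φ π ρ) =
      permMean (fun ρ => permMean fun π => φ π ρ) := by
  simp only [permMean, ← mul_sum]
  rw [sum_comm]

lemma permMean_ite_apply_eq (i j : V) :
    permMean (fun π : Equiv.Perm V => if π i = j then (1 : ℝ) else 0) =
      (Fintype.card V : ℝ)⁻¹ := by
  have hsym : ∀ j' : V, permMean (fun π : Equiv.Perm V => if π i = j' then (1 : ℝ) else 0) =
      permMean (fun π : Equiv.Perm V => if π i = j then (1 : ℝ) else 0) := by
    intro j'
    rw [← permMean_mul_left (Equiv.swap j j')]
    congr 1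
    funext π
    have : (Equiv.swap j j' * π) i = j' ↔ π i = j := by
      rw [Equiv.Perm.mul_apply, ← Equiv.eq_symm_apply]
      simp
    simp only [this]
  have htot : ∑ j' : V, permMean (fun π : Equiv.Perm V => if π i = j' then (1 : ℝ) else 0) = 1 := by
    rw [← permMean_sum]
    simp [permMean_const]
  rw [sum_congr rfl fun j' _ => hsym j', sum_const, card_univ, nsmul_eq_mul] at htot
  exact eq_inv_of_mul_eq_one_right htot

/-- Two functions of disjoint parts of a uniform random permutation are nearly uncorrelated. -/
lemma abs_permMean_mul_sub_le {α β : Type*} [Fintype α] [Fintype β] (u : α ↪ V) (v : β ↪ V)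
    (huv : ∀ i j, u i ≠ v j) (F₁ : (α ↪ V) → ℝ) (F₂ : (β ↪ V) → ℝ) {C₁ C₂ : ℝ}
    (h₁ : ∀ w, |F₁ w| ≤ C₁) (h₂ : ∀ w, |F₂ w| ≤ C₂) :
    |permMean (fun π => F₁ (u.trans π.toEmbedding) * F₂ (v.trans π.toEmbedding)) -
        permMean (fun π => F₁ (u.trans π.toEmbedding)) *
          permMean (fun π => F₂ (v.trans π.toEmbedding))| ≤
      2 * C₁ * C₂ * Fintype.card α * Fintype.card β / Fintype.card V := by
  have hC₁ : 0 ≤ C₁ := (abs_nonneg _).trans (h₁ u)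
  have hC₂ : 0 ≤ C₂ := (abs_nonneg _).trans (h₂ v)
  let Φ : Equiv.Perm V → ℝ := fun ρ =>
    permMean fun π => F₁ (u.trans π.toEmbedding) * F₂ (v.trans (π * ρ).toEmbedding)
  let S := permMean fun π : Equiv.Perm V =>
    F₁ (u.trans π.toEmbedding) * F₂ (v.trans π.toEmbedding)
  have hprod : permMean (fun π => F₁ (u.trans π.toEmbedding)) *
      permMean (fun π => F₂ (v.trans π.toEmbedding)) = permMean Φ := by
    simp only [Φ]
    rw [permMean_comm]
    rw [mul_comm, ← permMean_const_mul]
    congr 1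
    funext π
    rw [permMean_const_mul,
      permMean_mul_left π (fun ρ : Equiv.Perm V => F₂ (v.trans ρ.toEmbedding)), mul_comm]
  have hbound : ∀ ρ, |Φ ρ| ≤ C₁ * C₂ := fun ρ =>
    abs_permMean_le_of_forall fun π => by
      rw [abs_mul]; exact mul_le_mul (h₁ _) (h₂ _) (abs_nonneg _) hC₁
  have hS : |S| ≤ C₁ * C₂ :=
    abs_permMean_le_of_forall fun π => by
      rw [abs_mul]; exact mul_le_mul (h₁ _) (h₂ _) (abs_nonneg _) hC₁
  have hgood : ∀ ρ : Equiv.Perm V, (∀ i j, ρ (v j) ≠ u i) → Φ ρ = S := by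
    intro ρ hρ
    let e : α ⊕ β ↪ V := ⟨Sum.elim u v, u.injective.sumElim v.injective huv⟩
    let e' : α ⊕ β ↪ V := ⟨Sum.elim u (ρ ∘ v),
      u.injective.sumElim (ρ.injective.comp v.injective) fun i j => (hρ i j).symm⟩
    obtain ⟨θ, hθ⟩ := exists_perm_trans_eq e e'
    have hθu : ∀ i, θ (u i) = u i := fun i => DFunLike.congr_fun hθ (Sum.inl i)
    have hθv : ∀ j, θ (v j) = ρ (v j) := fun j => DFunLike.congr_fun hθ (Sum.inr j)
    simp only [Φ, S]
    rw [← permMean_mul_right θ (fun π : Equiv.Perm V =>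
      F₁ (u.trans π.toEmbedding) * F₂ (v.trans π.toEmbedding))]
    congr 1
    funext π
    have e1 : u.trans (π * θ).toEmbedding = u.trans π.toEmbedding := by
      ext i; simp [hθu]
    have e2 : v.trans (π * ρ).toEmbedding = v.trans (π * θ).toEmbedding := by
      ext j; simp [hθv]
    rw [e1, e2]
  have hpt : ∀ ρ, |S - Φ ρ| ≤
      ∑ i : α, ∑ j : β, 2 * C₁ * C₂ * (if ρ (v j) = u i then (1 : ℝ) else 0) := by
    intro ρ
    have hnn : ∀ i : α, ∀ j : β,
        0 ≤ 2 * C₁ * C₂ * (if ρ (v j) = u i then (1 : ℝ) else 0) := by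
      intro i j; split_ifs <;> positivity
    by_cases hρ : ∀ i j, ρ (v j) ≠ u i
    · rw [hgood ρ hρ, sub_self, abs_zero]
      exact sum_nonneg fun i _ => sum_nonneg fun j _ => hnn i j
    · push Not at hρ
      obtain ⟨i, j, hij⟩ := hρ
      calc |S - Φ ρ| ≤ |S| + |Φ ρ| := abs_sub _ _
        _ ≤ 2 * C₁ * C₂ * (if ρ (v j) = u i then (1 : ℝ) else 0) := by
          rw [if_pos hij]; linarith [hbound ρ]
        _ ≤ ∑ j : β, 2 * C₁ * C₂ * (if ρ (v j) = u i then (1 : ℝ) else 0) :=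
          single_le_sum (f := fun j => 2 * C₁ * C₂ * (if ρ (v j) = u i then (1 : ℝ) else 0))
            (fun j _ => hnn i j) (mem_univ j)
        _ ≤ _ := single_le_sum
            (f := fun i => ∑ j : β, 2 * C₁ * C₂ * (if ρ (v j) = u i then (1 : ℝ) else 0))
            (fun i _ => sum_nonneg fun j _ => hnn i j) (mem_univ i)
  change |S - _| ≤ _
  rw [hprod, ← permMean_const (V := V) S, ← permMean_sub]
  refine (abs_permMean_le _).trans ((permMean_mono hpt).trans_eq ?_)
  simp only [permMean_sum, permMean_const_mul, permMean_ite_apply_eq, sum_const, card_univ,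
    nsmul_eq_mul]
  ring

/-- The mean over all embeddings of `α` into `V` is a mean over permutations of `V`. -/
lemma sum_embedding_eq_permMean {α : Type*} [Fintype α] [DecidableEq α] (e : α ↪ V)
    (φ : (α ↪ V) → ℝ) :
    (Fintype.card (α ↪ V) : ℝ)⁻¹ * ∑ τ, φ τ =
      permMean fun π => φ (e.trans π.toEmbedding) := by
  have hind : ∀ τ : α ↪ V, permMean (fun π => φ (e.trans π.toEmbedding)) =
      permMean (fun π => φ (τ.trans π.toEmbedding)) := by
    intro τ
    obtain ⟨θ, rfl⟩ := exists_perm_trans_eq e τ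
    rw [← permMean_mul_right θ]
    congr 1
  have hπ : ∀ π : Equiv.Perm V, ∑ τ : α ↪ V, φ (τ.trans π.toEmbedding) = ∑ τ, φ τ := by
    intro π
    exact Equiv.sum_comp (Equiv.embeddingCongr (Equiv.refl α) π) φ
  have hne : (Fintype.card (α ↪ V) : ℝ) ≠ 0 := by
    have : Nonempty (α ↪ V) := ⟨e⟩
    exact_mod_cast Fintype.card_ne_zero
  have key : (Fintype.card (α ↪ V) : ℝ) * permMean (fun π => φ (e.trans π.toEmbedding)) =
      ∑ τ, φ τ := by
    calc _ = ∑ τ : α ↪ V, permMean (fun π => φ (τ.trans π.toEmbedding)) := by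
          rw [← sum_congr rfl fun τ _ => hind τ, sum_const, card_univ, nsmul_eq_mul]
      _ = permMean fun π => ∑ τ : α ↪ V, φ (τ.trans π.toEmbedding) := (permMean_sum _ _).symm
      _ = _ := by simp_rw [hπ]; rw [permMean_const]
  rw [← key]
  field_simp

end PermMean

/-- The mean of `f (D.map (π ∘ w) x)` over all permutations `π`. -/
noncomputable def embMean (D : BDS) {a c : Finset ℕ} (f : D.obj a → ℝ) (w : ↥a ↪ ↥c)
    (x : D.obj c) : ℝ :=
  permMean fun π : Equiv.Perm ↥c => f (D.map (w.trans π.toEmbedding) x)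

lemma BDS.map_trans (D : BDS) {c b a : Finset ℕ} (σ : ↥c ↪ ↥b) (τ : ↥b ↪ ↥a) (x : D.obj a) :
    D.map (σ.trans τ) x = D.map σ (D.map τ x) :=
  congrFun (D.map_comp σ τ) x

lemma abs_embMean_le {D : BDS} {a c : Finset ℕ} {f : D.obj a → ℝ} {C : ℝ}
    (hf : ∀ d, |f d| ≤ C) (w : ↥a ↪ ↥c) (x : D.obj c) : |embMean D f w x| ≤ C :=
  abs_permMean_le_of_forall fun _ => hf _

lemma measurable_embMean {D : BDS} {a c : Finset ℕ} {f : D.obj a → ℝ}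
    (hf : Measurable f) (w : ↥a ↪ ↥c) : Measurable (embMean D f w) := by
  unfold embMean permMean
  exact (Finset.measurable_sum _ fun π _ =>
    hf.comp (D.map_measurable (w.trans π.toEmbedding))).const_mul _

lemma embMean_comp_map {D : BDS} {a b c : Finset ℕ} (f : D.obj a → ℝ) (u : ↥a ↪ ↥b)
    (w : ↥b ↪ ↥c) (x : D.obj c) :
    embMean D (fun y => f (D.map u y)) w x = embMean D f (u.trans w) x := by
  simp only [embMean, ← BDS.map_trans]
  rfl

lemma embMean_map_perm {D : BDS} {a c : Finset ℕ} (f : D.obj a → ℝ) (w : ↥a ↪ ↥c)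
    (θ : Equiv.Perm ↥c) (x : D.obj c) :
    embMean D f w (D.map θ.toEmbedding x) = embMean D f w x := by
  simp only [embMean, ← BDS.map_trans]
  exact permMean_mul_left θ fun π => f (D.map (w.trans π.toEmbedding) x)

lemma avg_eq_embMean (D : BDS) {k n : ℕ} (g : D.obj (Finset.range k) → ℝ)
    (w : ↥(Finset.range k) ↪ ↥(Finset.range n)) (x : D.obj (Finset.range n)) :
    avg D k g n x = embMean D g w x := by
  have hkn : k ≤ n := by
    simpa using Fintype.card_le_of_embedding w
  have h := Nat.factorial_mul_descFactorial hkn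
  have hc : Fintype.card (↥(Finset.range k) ↪ ↥(Finset.range n)) = n.descFactorial k := by
    simp [Fintype.card_embedding_eq]
  have hr : (Nat.factorial (n - k) : ℝ) / (Nat.factorial n : ℝ) =
      (Fintype.card (↥(Finset.range k) ↪ ↥(Finset.range n)) : ℝ)⁻¹ := by
    rw [hc, ← h]
    have h1 : (Nat.factorial (n - k) : ℝ) ≠ 0 := by positivity
    push_cast
    rw [div_mul_eq_div_div, div_self h1, one_div]
  rw [avg, hr, embMean, ← sum_embedding_eq_permMean w (fun τ => g (D.map τ x))]

lemma abs_embMean_mul_sub_le {D : BDS} {a b c : Finset ℕ} {f : D.obj a → ℝ} {h : D.obj b → ℝ}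
    {C₁ C₂ : ℝ} (hf : ∀ d, |f d| ≤ C₁) (hh : ∀ d, |h d| ≤ C₂) (u : ↥a ↪ ↥c) (v : ↥b ↪ ↥c)
    (huv : ∀ i j, u i ≠ v j) (x : D.obj c) :
    |permMean (fun π : Equiv.Perm ↥c =>
          f (D.map u (D.map π.toEmbedding x)) * h (D.map v (D.map π.toEmbedding x))) -
        embMean D f u x * embMean D h v x| ≤
      2 * C₁ * C₂ * a.card * b.card / c.card := by
  have := abs_permMean_mul_sub_le u v huv (fun τ => f (D.map τ x)) (fun τ => h (D.map τ x))
    (fun τ => hf _) (fun τ => hh _)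
  simpa only [Fintype.card_coe, BDS.map_trans, embMean] using this

/-- A measurable, sampling consistent and exchangeable family. -/
structure IsExchMeasurement (D : BDS) {Ω : Type} [MeasurableSpace Ω] (P : Measure Ω)
    (X : ∀ a : Finset ℕ, Ω → D.obj a) : Prop where
  measurable : ∀ a, Measurable (X a)
  consistent : ∀ (b a : Finset ℕ) (h : b ⊆ a), ∀ᵐ ω ∂P, D.map (inclEmb h) (X a ω) = X b ω
  exchangeable : ∀ (a : Finset ℕ) (π : ↥a ≃ ↥a),
    Measure.map (fun ω => D.map π.toEmbedding (X a ω)) P = Measure.map (X a) P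

lemma range_disjoint_shift {k n : ℕ} (h : 2 * k ≤ n) :
    ∃ w : ↥(Finset.range k) ↪ ↥(Finset.range n), ∀ i, (w i : ℕ) = k + i := by
  refine ⟨⟨fun i => ⟨k + i, ?_⟩, ?_⟩, fun i => rfl⟩
  · have := Finset.mem_range.1 i.2
    exact Finset.mem_range.2 (by omega)
  · intro i j hij
    have := congrArg Subtype.val hij
    simp only at this
    exact Subtype.ext (by omega)

namespace IsExchMeasurement

variable {D : BDS} {Ω : Type} [MeasurableSpace Ω] {P : Measure Ω}
  {X : ∀ a : Finset ℕ, Ω → D.obj a}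

lemma measurable_map (H : IsExchMeasurement D P X) {a c : Finset ℕ} (w : ↥a ↪ ↥c) :
    Measurable fun ω => D.map w (X c ω) :=
  (D.map_measurable w).comp (H.measurable c)

lemma integral_map_perm (H : IsExchMeasurement D P X) {c : Finset ℕ} (π : Equiv.Perm ↥c)
    {Φ : D.obj c → ℝ} (hΦ : Measurable Φ) :
    ∫ ω, Φ (D.map π.toEmbedding (X c ω)) ∂P = ∫ ω, Φ (X c ω) ∂P := by
  rw [← integral_map (φ := fun ω => D.map π.toEmbedding (X c ω)) (f := Φ)
      (H.measurable_map _).aemeasurable hΦ.aestronglyMeasurable,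
    H.exchangeable c π, integral_map (H.measurable c).aemeasurable hΦ.aestronglyMeasurable]

lemma integral_map_emb (H : IsExchMeasurement D P X) {a c : Finset ℕ} (hac : a ⊆ c)
    (w : ↥a ↪ ↥c) {f : D.obj a → ℝ} (hf : Measurable f) :
    ∫ ω, f (D.map w (X c ω)) ∂P = ∫ ω, f (X a ω) ∂P := by
  obtain ⟨π, rfl⟩ := exists_perm_trans_eq (inclEmb hac) w
  simp only [BDS.map_trans]
  rw [H.integral_map_perm π (Φ := fun y => f (D.map (inclEmb hac) y))
    (hf.comp (D.map_measurable _))]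
  refine integral_congr_ae ?_
  filter_upwards [H.consistent a c hac] with ω hω
  rw [hω]

variable [IsProbabilityMeasure P]

lemma integrable_comp {E : Type*} [MeasurableSpace E] {Y : Ω → E} (hY : Measurable Y)
    {f : E → ℝ} (hf : Measurable f) {C : ℝ} (hC : ∀ d, |f d| ≤ C) :
    Integrable (fun ω => f (Y ω)) P :=
  Integrable.of_bound (hf.comp hY).aestronglyMeasurable C
    (Filter.Eventually.of_forall fun _ => hC _)

lemma integral_permMean (H : IsExchMeasurement D P X) {c : Finset ℕ}
    {Φ : D.obj c → ℝ} (hΦ : Measurable Φ) {C : ℝ} (hC : ∀ d, |Φ d| ≤ C) :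
    ∫ ω, permMean (fun π : Equiv.Perm ↥c => Φ (D.map π.toEmbedding (X c ω))) ∂P =
      ∫ ω, Φ (X c ω) ∂P := by
  simp only [permMean]
  rw [integral_const_mul, integral_finsetSum _ fun π _ =>
    integrable_comp (H.measurable_map _) hΦ hC]
  simp only [H.integral_map_perm _ hΦ]
  exact permMean_const (V := ↥c) (∫ ω, Φ (X c ω) ∂P)

/-- Expectations over disjoint parts of the sample are nearly expectations of products
of empirical means. -/
lemma abs_integral_mul_sub_le (H : IsExchMeasurement D P X) {a b c : Finset ℕ}
    {f : D.obj a → ℝ} {h : D.obj b → ℝ} (mf : Measurable f) (mh : Measurable h)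
    {C₁ C₂ : ℝ} (hf : ∀ d, |f d| ≤ C₁) (hh : ∀ d, |h d| ≤ C₂) (u : ↥a ↪ ↥c) (v : ↥b ↪ ↥c)
    (huv : ∀ i j, u i ≠ v j) :
    |∫ ω, f (D.map u (X c ω)) * h (D.map v (X c ω)) ∂P -
        ∫ ω, embMean D f u (X c ω) * embMean D h v (X c ω) ∂P| ≤
      2 * C₁ * C₂ * a.card * b.card / c.card := by
  have mΦ : Measurable fun y : D.obj c => f (D.map u y) * h (D.map v y) :=
    (mf.comp (D.map_measurable _)).mul (mh.comp (D.map_measurable _))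
  have mul_bd : ∀ {p q : ℝ}, |p| ≤ C₁ → |q| ≤ C₂ → |p * q| ≤ C₁ * C₂ := fun hp hq => by
    rw [abs_mul]; exact mul_le_mul hp hq (abs_nonneg _) ((abs_nonneg _).trans hp)
  rw [← H.integral_permMean mΦ (C := C₁ * C₂) fun d => mul_bd (hf _) (hh _), ← integral_sub]
  · rw [← Real.norm_eq_abs]
    refine (norm_integral_le_of_norm_le_const (μ := P)
      (C := 2 * C₁ * C₂ * a.card * b.card / c.card) ?_).trans ?_
    · exact Filter.Eventually.of_forall fun ω => abs_embMean_mul_sub_le hf hh u v huv (X c ω)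
    · rw [probReal_univ, mul_one]
  · simp only [permMean]
    exact (integrable_finsetSum _ fun π _ =>
      integrable_comp (H.measurable_map _) mΦ fun d => mul_bd (hf _) (hh _)).const_mul _
  · exact integrable_comp (H.measurable c)
      ((measurable_embMean mf u).mul (measurable_embMean mh v))
      fun d => mul_bd (abs_embMean_le hf u d) (abs_embMean_le hh v d)

end IsExchMeasurement

lemma exists_subseq_tendsto_ae_of_integral_sq_sub {Ω : Type*} [MeasurableSpace Ω]
    {P : Measure Ω} [IsProbabilityMeasure P] {f : ℕ → Ω → ℝ} (hf : ∀ n, Measurable (f n))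
    {C : ℝ} (hC : ∀ n ω, |f n ω| ≤ C)
    (hcauchy : ∀ ε : ℝ, 0 < ε → ∃ N, ∀ n m, N ≤ n → n ≤ m → ∫ ω, (f n ω - f m ω) ^ 2 ∂P < ε) :
    ∃ (φ : ℕ → ℕ) (Z : Ω → ℝ), StrictMono φ ∧
      ∀ᵐ ω ∂P, Filter.Tendsto (fun j => f (φ j) ω) Filter.atTop (nhds (Z ω)) := by
  have hmem : ∀ n, MemLp (f n) 2 P := fun n =>
    MemLp.of_bound (hf n).aestronglyMeasurable C (Filter.Eventually.of_forall (hC n))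
  have hdist : ∀ n m, edist ((hmem n).toLp (f n)) ((hmem m).toLp (f m)) =
      ENNReal.ofReal (√(∫ ω, (f n ω - f m ω) ^ 2 ∂P)) := by
    intro n m
    rw [Lp.edist_toLp_toLp, ((hmem n).sub (hmem m)).eLpNorm_eq_integral_rpow_norm (by simp)
      (by simp)]
    simp [Real.sqrt_eq_rpow]
  have hcs : CauchySeq fun n => (hmem n).toLp (f n) := by
    rw [EMetric.cauchySeq_iff']
    intro ε hε
    obtain ⟨r, hr0, hr⟩ := ENNReal.lt_iff_exists_nnreal_btwn.1 hε
    have hr0' : (0 : ℝ) < r := by exact_mod_cast hr0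
    obtain ⟨N, hN⟩ := hcauchy ((r : ℝ) ^ 2) (by positivity)
    refine ⟨N, fun n hn => ?_⟩
    rw [edist_comm, hdist]
    refine lt_of_le_of_lt ?_ hr
    rw [← ENNReal.ofReal_coe_nnreal]
    refine ENNReal.ofReal_le_ofReal ?_
    exact (Real.sqrt_le_left hr0'.le).2 (hN N n le_rfl hn).le
  obtain ⟨Z, hZ⟩ := cauchySeq_tendsto_of_complete hcs
  obtain ⟨φ, hφ, hlim⟩ := (tendstoInMeasure_of_tendsto_Lp hZ).exists_seq_tendsto_ae
  refine ⟨φ, Z, hφ, ?_⟩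
  have hae : ∀ᵐ ω ∂P, ∀ n, (hmem n).toLp (f n) ω = f n ω :=
    ae_all_iff.2 fun n => (hmem n).coeFn_toLp
  filter_upwards [hlim, hae] with ω h1 h2
  simpa only [h2] using h1

lemma integral_sub_sq {Ω : Type*} [MeasurableSpace Ω] {P : Measure Ω} {f h : Ω → ℝ}
    (hff : Integrable (fun ω => f ω * f ω) P) (hhh : Integrable (fun ω => h ω * h ω) P)
    (hfh : Integrable (fun ω => f ω * h ω) P) :
    ∫ ω, (f ω - h ω) ^ 2 ∂P =
      ∫ ω, f ω * f ω ∂P + ∫ ω, h ω * h ω ∂P - 2 * ∫ ω, f ω * h ω ∂P := by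
  rw [← integral_const_mul, ← integral_add hff hhh,
    ← integral_sub (f := fun ω => f ω * f ω + h ω * h ω) (hff.add hhh) (hfh.const_mul 2)]
  congr 1
  funext ω
  ring

namespace IsExchMeasurement

variable {D : BDS} {Ω : Type} [MeasurableSpace Ω] {P : Measure Ω} [IsProbabilityMeasure P]
  {X : ∀ a : Finset ℕ, Ω → D.obj a}

lemma integral_embMean_mul_embMean (H : IsExchMeasurement D P X) {a b c d : Finset ℕ}
    (hcd : c ⊆ d) {f : D.obj a → ℝ} {h : D.obj b → ℝ} (mf : Measurable f) (mh : Measurable h)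
    {C₁ C₂ : ℝ} (hf : ∀ y, |f y| ≤ C₁) (hh : ∀ y, |h y| ≤ C₂) (w : ↥a ↪ ↥c) (v : ↥b ↪ ↥d)
    (hac : a ⊆ c) :
    ∫ ω, embMean D f w (X c ω) * embMean D h v (X d ω) ∂P =
      ∫ ω, f (X a ω) * embMean D h v (X d ω) ∂P := by
  have mh' := measurable_embMean mh v
  have key : ∀ τ : ↥a ↪ ↥c, ∫ ω, f (D.map τ (X c ω)) * embMean D h v (X d ω) ∂P =
      ∫ ω, f (X a ω) * embMean D h v (X d ω) ∂P := by
    intro τ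
    obtain ⟨π, hπ⟩ := exists_perm_trans_eq (inclEmb (hac.trans hcd)) (τ.trans (inclEmb hcd))
    have hΦ : Measurable fun y => f (D.map (inclEmb (hac.trans hcd)) y) * embMean D h v y :=
      (mf.comp (D.map_measurable _)).mul mh'
    calc _ = ∫ ω, f (D.map (τ.trans (inclEmb hcd)) (X d ω)) * embMean D h v (X d ω) ∂P := by
          refine integral_congr_ae ?_
          filter_upwards [H.consistent c d hcd] with ω hω
          rw [BDS.map_trans, hω]
      _ = ∫ ω, f (D.map (inclEmb (hac.trans hcd)) (D.map π.toEmbedding (X d ω))) *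
            embMean D h v (D.map π.toEmbedding (X d ω)) ∂P := by
          simp only [← hπ, BDS.map_trans, embMean_map_perm]
      _ = ∫ ω, f (D.map (inclEmb (hac.trans hcd)) (X d ω)) * embMean D h v (X d ω) ∂P :=
          H.integral_map_perm π hΦ
      _ = _ := by
          refine integral_congr_ae ?_
          filter_upwards [H.consistent a d (hac.trans hcd)] with ω hω
          rw [hω]
  have hint : ∀ τ : ↥a ↪ ↥c,
      Integrable (fun ω => f (D.map τ (X c ω)) * embMean D h v (X d ω)) P := fun τ =>
    Integrable.of_bound (((mf.comp (H.measurable_map τ)).mul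
      (mh'.comp (H.measurable d))).aestronglyMeasurable) (C₁ * C₂)
      (Filter.Eventually.of_forall fun ω => by
        rw [Real.norm_eq_abs, abs_mul]
        exact mul_le_mul (hf _) (abs_embMean_le hh v _) (abs_nonneg _)
          ((abs_nonneg _).trans (hf (X a ω))))
  conv_lhs => simp only [embMean.eq_1 D f, permMean, mul_assoc, Finset.sum_mul]
  rw [integral_const_mul, integral_finsetSum _ fun π _ => hint _]
  simp only [key]
  exact permMean_const (V := ↥c) _

lemma integral_embMean (H : IsExchMeasurement D P X) {a c : Finset ℕ} {f : D.obj a → ℝ}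
    (mf : Measurable f) {C : ℝ} (hf : ∀ y, |f y| ≤ C) (w : ↥a ↪ ↥c) (hac : a ⊆ c) :
    ∫ ω, embMean D f w (X c ω) ∂P = ∫ ω, f (X a ω) ∂P := by
  simp only [embMean, BDS.map_trans]
  rw [H.integral_permMean (Φ := fun y => f (D.map w y)) (mf.comp (D.map_measurable w))
    (fun _ => hf _)]
  exact H.integral_map_emb hac w mf

variable {k : ℕ} {g : D.obj (Finset.range k) → ℝ} {C : ℝ}

lemma range_le {n m : ℕ} (h : n ≤ m) : Finset.range n ⊆ Finset.range m :=
  Finset.range_subset_range.2 h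

lemma integral_avg (H : IsExchMeasurement D P X) (mg : Measurable g) (hg : ∀ y, |g y| ≤ C)
    {n : ℕ} (hn : k ≤ n) :
    ∫ ω, avg D k g n (X _ ω) ∂P = ∫ ω, g (X _ ω) ∂P := by
  simp only [avg_eq_embMean D g (inclEmb (range_le hn))]
  exact H.integral_embMean mg hg _ (range_le hn)

lemma integral_avg_mul_avg (H : IsExchMeasurement D P X) (mg : Measurable g)
    (hg : ∀ y, |g y| ≤ C) {n m : ℕ} (hn : k ≤ n) (hm : n ≤ m) :
    ∫ ω, avg D k g n (X _ ω) * avg D k g m (X _ ω) ∂P =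
      ∫ ω, avg D k g m (X _ ω) * avg D k g m (X _ ω) ∂P := by
  simp only [avg_eq_embMean D g (inclEmb (range_le hn)),
    avg_eq_embMean D g (inclEmb (range_le (hn.trans hm)))]
  rw [H.integral_embMean_mul_embMean (range_le hm) mg mg hg hg _ _ (range_le hn),
    H.integral_embMean_mul_embMean subset_rfl mg mg hg hg _ _ (range_le (hn.trans hm))]

lemma abs_integral_sub_integral_avg_mul_self_le (H : IsExchMeasurement D P X)
    (mg : Measurable g) (hg : ∀ y, |g y| ≤ C)
    {w : ↥(Finset.range k) ↪ ↥(Finset.range (2 * k))} (hw : ∀ i, (w i : ℕ) = k + i)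
    {n : ℕ} (hn : 2 * k ≤ n) :
    |∫ ω, g (X _ ω) * g (D.map w (X _ ω)) ∂P -
        ∫ ω, avg D k g n (X _ ω) * avg D k g n (X _ ω) ∂P| ≤ 2 * C * C * k * k / n := by
  have hkn : k ≤ n := by omega
  have h := H.abs_integral_mul_sub_le mg mg hg hg (inclEmb (range_le hkn))
    (w.trans (inclEmb (range_le hn))) (fun i j hij => by
      have h1 := congrArg Subtype.val hij
      have h2 : ((i : ℕ)) = w j := h1
      have := Finset.mem_range.1 i.2
      rw [hw] at h2
      omega)
  simp only [← avg_eq_embMean, Finset.card_range] at h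
  convert h using 3
  refine integral_congr_ae ?_
  filter_upwards [H.consistent _ _ (range_le hkn), H.consistent _ _ (range_le hn)] with ω h1 h2
  rw [BDS.map_trans, h1, h2]

lemma measurable_avg (n : ℕ) (mg : Measurable g) : Measurable (avg D k g n) := by
  unfold avg
  exact (Finset.measurable_sum _ fun τ _ => mg.comp (D.map_measurable τ)).const_mul _

lemma abs_avg_le (hg : ∀ y, |g y| ≤ C) {n : ℕ} (hn : k ≤ n) (x : D.obj (Finset.range n)) :
    |avg D k g n x| ≤ C := by
  rw [avg_eq_embMean D g (inclEmb (range_le hn))]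
  exact abs_embMean_le hg _ _

lemma exists_avg_subseq_tendsto_ae (H : IsExchMeasurement D P X)
    (mg : Measurable g) (hg : ∀ y, |g y| ≤ C) :
    ∃ (φ : ℕ → ℕ) (Z : Ω → ℝ), StrictMono φ ∧ (∀ j, k ≤ φ j) ∧
      ∀ᵐ ω ∂P, Filter.Tendsto (fun j => avg D k g (φ j) (X _ ω)) Filter.atTop
        (nhds (Z ω)) := by
  obtain ⟨w, hw⟩ := range_disjoint_shift (k := k) le_rfl
  have hbd : ∀ n ω, |avg D k g (k + n) (X _ ω)| ≤ C := fun n ω => abs_avg_le hg (by omega) _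
  obtain ⟨φ, Z, hφ, hZ⟩ := exists_subseq_tendsto_ae_of_integral_sq_sub (P := P)
    (f := fun n ω => avg D k g (k + n) (X _ ω))
    (fun n => (measurable_avg _ mg).comp (H.measurable _)) hbd (by
      intro ε hε
      obtain ⟨N, hN⟩ := exists_nat_gt (2 * (2 * C * C * k * k) / ε)
      refine ⟨max N k, fun n m hn hm => ?_⟩
      have h1 := H.abs_integral_sub_integral_avg_mul_self_le mg hg hw (n := k + n)
        (by have := le_of_max_le_right hn; omega)
      have h2 := H.abs_integral_sub_integral_avg_mul_self_le mg hg hw (n := k + m)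
        (by have := le_of_max_le_right hn; omega)
      have hint : ∀ p q, Integrable
          (fun ω => avg D k g (k + p) (X _ ω) * avg D k g (k + q) (X _ ω)) P := fun p q =>
        Integrable.of_bound ((((measurable_avg _ mg).comp (H.measurable _)).mul
          ((measurable_avg _ mg).comp (H.measurable _))).aestronglyMeasurable) (C * C)
          (Filter.Eventually.of_forall fun ω => by
            rw [Real.norm_eq_abs, abs_mul]
            exact mul_le_mul (hbd _ _) (hbd _ _) (abs_nonneg _) ((abs_nonneg _).trans (hbd p ω)))
      have hexp : ∫ ω, (avg D k g (k + n) (X _ ω) - avg D k g (k + m) (X _ ω)) ^ 2 ∂P =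
          ∫ ω, avg D k g (k + n) (X _ ω) * avg D k g (k + n) (X _ ω) ∂P -
            ∫ ω, avg D k g (k + m) (X _ ω) * avg D k g (k + m) (X _ ω) ∂P := by
        have hc := H.integral_avg_mul_avg mg hg (n := k + n) (m := k + m) (by omega) (by omega)
        rw [integral_sub_sq (hint _ _) (hint _ _) (hint _ _), hc]
        ring
      rw [hexp]
      have hK : 0 ≤ 2 * C * C * k * k := by
        have := mul_self_nonneg C
        have h' : (0 : ℝ) ≤ 2 * (C * C) * (k * k) := by positivity
        linarith
      have hN0 : (0 : ℝ) < N := lt_of_le_of_lt (by positivity) hN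
      have hnle : ∀ p : ℕ, max N k ≤ p →
          2 * C * C * k * k / ((k + p : ℕ) : ℝ) ≤ 2 * C * C * k * k / N := fun p hp =>
        div_le_div_of_nonneg_left hK hN0 (by
          exact_mod_cast (le_of_max_le_left hp).trans (Nat.le_add_left p k))
      have h3 := hnle n hn
      have h4 := hnle m (hn.trans hm)
      have h5 : 2 * (2 * C * C * k * k / N) < ε := by
        rw [div_lt_iff₀ hε] at hN
        rw [mul_div_assoc', div_lt_iff₀ hN0]
        linarith
      rw [abs_le] at h1 h2
      linarith [h1.1, h2.2])
  exact ⟨fun j => k + φ j, Z, fun i j hij => Nat.add_lt_add_left (hφ hij) k,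
    fun j => Nat.le_add_right _ _, hZ⟩

end IsExchMeasurement

lemma avg_map_emb {D : BDS} {k : ℕ} (g : D.obj (Finset.range k) → ℝ) {n : ℕ} {c : Finset ℕ}
    (hc : c = Finset.range n) (τ : ↥(Finset.range n) ↪ ↥c) (x : ∀ a : Finset ℕ, D.obj a) :
    avg D k g n (D.map τ (x c)) = avg D k g n (x (Finset.range n)) := by
  subst hc
  simp only [avg, ← BDS.map_trans]
  congr 1
  let θ : Equiv.Perm ↥(Finset.range n) := τ.equivOfFiniteSelfEmbedding
  have hθ : θ.toEmbedding = τ := by ext; rfl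
  rw [← hθ]
  exact Equiv.sum_comp (Equiv.embeddingCongr (Equiv.refl _) θ) fun σ => g (D.map σ (x _))

lemma exists_forall_perm_lt_iff {π : Equiv.Perm ℕ} (hπ : {i : ℕ | π i ≠ i}.Finite) :
    ∃ N, ∀ n, N ≤ n → ∀ i, π i < n ↔ i < n := by
  obtain ⟨N, hN⟩ := hπ.bddAbove
  refine ⟨N + 1, fun n hn i => ?_⟩
  by_cases h : π i = i
  · rw [h]
  · have h1 : i ≤ N := hN h
    have h2 : π i ≤ N := hN fun h' => h (π.injective h')
    omega

lemma image_range_eq {π : Equiv.Perm ℕ} {n : ℕ} (h : ∀ i, π i < n ↔ i < n) :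
    (Finset.range n).image π = Finset.range n := by
  ext j
  simp only [Finset.mem_image, Finset.mem_range]
  constructor
  · rintro ⟨i, hi, rfl⟩
    exact (h i).2 hi
  · intro hj
    exact ⟨π.symm j, (h _).1 (by simpa using hj), by simp⟩

lemma measurable_permAct (D : BDS) (π : Equiv.Perm ℕ) : Measurable (permAct D π) :=
  measurable_pi_lambda _ fun b => (D.map_measurable (permEmb π b)).comp (measurable_pi_apply _)

lemma measure_inter_preimage_eq_mul_of_integral_indicator {Ω E F : Type*} [MeasurableSpace Ω]
    [MeasurableSpace E] [MeasurableSpace F] {P : Measure Ω} [IsProbabilityMeasure P] {Y : Ω → E}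
    {Z : Ω → F} (hY : Measurable Y) (hZ : Measurable Z) {A : Set E} {B : Set F}
    (hA : MeasurableSet A) (hB : MeasurableSet B)
    (h : ∫ ω, A.indicator (fun _ => (1 : ℝ)) (Y ω) * B.indicator (fun _ => (1 : ℝ)) (Z ω) ∂P =
      (∫ ω, A.indicator (fun _ => (1 : ℝ)) (Y ω) ∂P) *
        ∫ ω, B.indicator (fun _ => (1 : ℝ)) (Z ω) ∂P) :
    P (Y ⁻¹' A ∩ Z ⁻¹' B) = P (Y ⁻¹' A) * P (Z ⁻¹' B) := by
  have e0 : ∀ ω, A.indicator (fun _ => (1 : ℝ)) (Y ω) * B.indicator (fun _ => (1 : ℝ)) (Z ω) =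
      (Y ⁻¹' A ∩ Z ⁻¹' B).indicator 1 ω := fun ω => by
    by_cases ha : Y ω ∈ A <;> by_cases hb : Z ω ∈ B <;> simp [ha, hb]
  have e1 : ∀ ω, A.indicator (fun _ => (1 : ℝ)) (Y ω) = (Y ⁻¹' A).indicator 1 ω := fun _ => rfl
  have e2 : ∀ ω, B.indicator (fun _ => (1 : ℝ)) (Z ω) = (Z ⁻¹' B).indicator 1 ω := fun _ => rfl
  simp only [e0] at h
  simp only [e1, e2] at h
  rw [integral_indicator_one ((hY hA).inter (hZ hB)), integral_indicator_one (hY hA),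
    integral_indicator_one (hZ hB)] at h
  simp only [measureReal_def, ← ENNReal.toReal_mul] at h
  exact (ENNReal.toReal_eq_toReal_iff' (measure_ne_top _ _)
    (ENNReal.mul_ne_top (measure_ne_top _ _) (measure_ne_top _ _))).1 h

lemma indepFun_of_integral_indicator {Ω E F : Type*} [MeasurableSpace Ω] [MeasurableSpace E]
    [MeasurableSpace F] {P : Measure Ω} [IsProbabilityMeasure P] {Y : Ω → E} {Z : Ω → F}
    (hY : Measurable Y) (hZ : Measurable Z)
    (h : ∀ A B, MeasurableSet A → MeasurableSet B →
      ∫ ω, A.indicator (fun _ => (1 : ℝ)) (Y ω) * B.indicator (fun _ => (1 : ℝ)) (Z ω) ∂P =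
        (∫ ω, A.indicator (fun _ => (1 : ℝ)) (Y ω) ∂P) *
          ∫ ω, B.indicator (fun _ => (1 : ℝ)) (Z ω) ∂P) :
    IndepFun Y Z P :=
  indepFun_iff_measure_inter_preimage_eq_mul.2 fun A B hA hB =>
    measure_inter_preimage_eq_mul_of_integral_indicator hY hZ hA hB (h A B hA hB)

lemma abs_indicator_one_le {E : Type*} (A : Set E) (y : E) :
    |A.indicator (fun _ => (1 : ℝ)) y| ≤ 1 := by
  by_cases h : y ∈ A <;> simp [h]

/-- A finite set of natural numbers is contained in an initial segment. -/
lemma exists_subset_range (a : Finset ℕ) : ∃ k, a ⊆ Finset.range k :=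
  ⟨a.sup id + 1, fun _ hi => Finset.mem_range.2 (Nat.lt_succ_of_le (Finset.le_sup (f := id) hi))⟩

namespace IsExchMeasurement

variable {D : BDS} {Ω : Type} [MeasurableSpace Ω] {P : Measure Ω} [IsProbabilityMeasure P]
  {X : ∀ a : Finset ℕ, Ω → D.obj a} {k : ℕ} {g : D.obj (Finset.range k) → ℝ} {C : ℝ}

lemma exists_ae_eq_const_of_ergodic
    (herg : ∀ M : Set (∀ a : Finset ℕ, D.obj a), MeasurableSet M →
      (∀ π : Equiv.Perm ℕ, ({i : ℕ | π i ≠ i}).Finite →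
        ∀ x ∈ limitSet D, (permAct D π x ∈ M ↔ x ∈ M)) →
      P ((fun ω => fun a => X a ω) ⁻¹' M) = 0 ∨ P ((fun ω => fun a => X a ω) ⁻¹' M) = 1)
    (H : IsExchMeasurement D P X) {L : (∀ a : Finset ℕ, D.obj a) → ℝ} (hL : Measurable L)
    (hinv : ∀ π : Equiv.Perm ℕ, ({i : ℕ | π i ≠ i}).Finite → ∀ x, L (permAct D π x) = L x) :
    ∃ r : ℝ, ∀ᵐ ω ∂P, L (fun a => X a ω) = r := by
  refine Filter.exists_eventuallyEq_const_of_forall_separating (l := ae P)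
    (f := fun ω => L fun a => X a ω) MeasurableSet fun U hU => ?_
  have hM : MeasurableSet ((fun ω => fun a => X a ω) ⁻¹' (L ⁻¹' U)) :=
    (measurable_pi_lambda _ H.measurable) (hL hU)
  rcases herg (L ⁻¹' U) (hL hU) fun π hπ x _ => by
    rw [Set.mem_preimage, Set.mem_preimage, hinv π hπ x] with h0 | h1
  · exact Or.inr (measure_eq_zero_iff_ae_notMem.1 h0)
  · exact Or.inl ((prob_compl_eq_zero_iff hM).2 h1)

lemma exists_avg_subseq_tendsto_integral_of_ergodic
    (herg : ∀ M : Set (∀ a : Finset ℕ, D.obj a), MeasurableSet M →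
      (∀ π : Equiv.Perm ℕ, ({i : ℕ | π i ≠ i}).Finite →
        ∀ x ∈ limitSet D, (permAct D π x ∈ M ↔ x ∈ M)) →
      P ((fun ω => fun a => X a ω) ⁻¹' M) = 0 ∨ P ((fun ω => fun a => X a ω) ⁻¹' M) = 1)
    (H : IsExchMeasurement D P X) (mg : Measurable g) (hg : ∀ y, |g y| ≤ C) :
    ∃ φ : ℕ → ℕ, StrictMono φ ∧ (∀ j, k ≤ φ j) ∧
      ∀ᵐ ω ∂P, Filter.Tendsto (fun j => avg D k g (φ j) (X _ ω)) Filter.atTop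
        (nhds (∫ ω, g (X _ ω) ∂P)) := by
  obtain ⟨φ, Z, hφ, hk, hZ⟩ := H.exists_avg_subseq_tendsto_ae mg hg
  obtain ⟨r, hr⟩ := exists_ae_eq_const_of_ergodic herg H
    (L := fun x => Filter.limsup (fun j => avg D k g (φ j) (x (Finset.range (φ j)))) Filter.atTop)
    (Measurable.limsup fun j => (measurable_avg _ mg).comp (measurable_pi_apply _)) (by
      intro π hπ x
      obtain ⟨N, hN⟩ := exists_forall_perm_lt_iff hπ
      refine Filter.limsup_congr ?_
      filter_upwards [hφ.tendsto_atTop.eventually_ge_atTop N] with j hj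
      exact avg_map_emb g (image_range_eq (hN _ hj)) (permEmb π (Finset.range (φ j))) x)
  have hlim : ∀ᵐ ω ∂P,
      Filter.Tendsto (fun j => avg D k g (φ j) (X _ ω)) Filter.atTop (nhds r) := by
    filter_upwards [hZ, hr] with ω h1 h2
    rwa [← h2, h1.limsup_eq]
  have hint := tendsto_integral_of_dominated_convergence (fun _ => C)
    (fun j => ((measurable_avg (φ j) mg).comp (H.measurable _)).aestronglyMeasurable)
    (integrable_const C) (fun j => Filter.Eventually.of_forall fun ω => abs_avg_le hg (hk j) _)
    hlim
  have hconst : ∀ j, ∫ ω, (avg D k g (φ j) ∘ X (Finset.range (φ j))) ω ∂P =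
      ∫ ω, g (X _ ω) ∂P := fun j => H.integral_avg mg hg (hk j)
  simp only [hconst, integral_const, probReal_univ, one_smul] at hint
  have : ∫ ω, g (X _ ω) ∂P = r := tendsto_nhds_unique tendsto_const_nhds hint
  exact ⟨φ, hφ, hk, by rwa [this]⟩

lemma tendsto_const_div_subseq (K : ℝ) {φ : ℕ → ℕ} (hφ : Filter.Tendsto φ Filter.atTop Filter.atTop) :
    Filter.Tendsto (fun j => K / (φ j : ℝ)) Filter.atTop (nhds 0) :=
  (tendsto_const_div_atTop_nhds_zero_nat K).comp hφ

lemma indepFun_of_ergodic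
    (herg : ∀ M : Set (∀ a : Finset ℕ, D.obj a), MeasurableSet M →
      (∀ π : Equiv.Perm ℕ, ({i : ℕ | π i ≠ i}).Finite →
        ∀ x ∈ limitSet D, (permAct D π x ∈ M ↔ x ∈ M)) →
      P ((fun ω => fun a => X a ω) ⁻¹' M) = 0 ∨ P ((fun ω => fun a => X a ω) ⁻¹' M) = 1)
    (H : IsExchMeasurement D P X) {a b : Finset ℕ} (hab : Disjoint a b) :
    IndepFun (X a) (X b) P := by
  refine indepFun_of_integral_indicator (H.measurable a) (H.measurable b) fun A B hA hB => ?_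
  set f := A.indicator fun _ => (1 : ℝ)
  set h := B.indicator fun _ => (1 : ℝ)
  have mf : Measurable f := measurable_const.indicator hA
  have mh : Measurable h := measurable_const.indicator hB
  have hf : ∀ y, |f y| ≤ 1 := abs_indicator_one_le A
  have hh : ∀ y, |h y| ≤ 1 := abs_indicator_one_le B
  obtain ⟨k, hk⟩ := exists_subset_range (a ∪ b)
  have hak := Finset.union_subset_left hk
  have hbk := Finset.union_subset_right hk
  have mf' : Measurable fun y => f (D.map (inclEmb hak) y) := mf.comp (D.map_measurable _)
  have mh' : Measurable fun y => h (D.map (inclEmb hbk) y) := mh.comp (D.map_measurable _)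
  have ef : ∫ ω, f (D.map (inclEmb hak) (X _ ω)) ∂P = ∫ ω, f (X a ω) ∂P :=
    H.integral_map_emb hak _ mf
  have eh : ∫ ω, h (D.map (inclEmb hbk) (X _ ω)) ∂P = ∫ ω, h (X b ω) ∂P :=
    H.integral_map_emb hbk _ mh
  obtain ⟨φ, hφ, hkφ, hlim⟩ := exists_avg_subseq_tendsto_integral_of_ergodic herg H mf'
    (fun _ => hf _)
  rw [ef] at hlim
  have hprod : ∀ j, |∫ ω, f (X a ω) * h (X b ω) ∂P -
      ∫ ω, avg D k (fun y => f (D.map (inclEmb hak) y)) (φ j) (X _ ω) *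
        avg D k (fun y => h (D.map (inclEmb hbk) y)) (φ j) (X _ ω) ∂P| ≤
      2 * 1 * 1 * a.card * b.card / φ j := by
    intro j
    have hkj := range_le (hkφ j)
    have := H.abs_integral_mul_sub_le mf mh hf hh ((inclEmb hak).trans (inclEmb hkj))
      ((inclEmb hbk).trans (inclEmb hkj)) fun i i' hii =>
        Finset.disjoint_left.1 hab i.2 (by
          have h' : (i : ℕ) = i' := congrArg Subtype.val hii
          rw [h']; exact i'.2)
    simp only [avg_eq_embMean D _ (inclEmb hkj), embMean_comp_map]
    rw [Finset.card_range] at this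
    convert this using 3
    refine integral_congr_ae ?_
    filter_upwards [H.consistent _ _ hak, H.consistent _ _ hbk, H.consistent _ _ hkj]
      with ω h1 h2 h3
    rw [BDS.map_trans, BDS.map_trans, h3, h1, h2]
  have hint := tendsto_integral_of_dominated_convergence (μ := P)
    (F := fun j ω => (avg D k (fun y => f (D.map (inclEmb hak) y)) (φ j) (X _ ω) -
      ∫ ω, f (X a ω) ∂P) * avg D k (fun y => h (D.map (inclEmb hbk) y)) (φ j) (X _ ω))
    (f := fun _ => 0) (fun _ => 2 * 1)
    (fun j => ((((measurable_avg (φ j) mf').comp (H.measurable _)).sub_const _).mul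
      ((measurable_avg (φ j) mh').comp (H.measurable _))).aestronglyMeasurable)
    (integrable_const _)
    (fun j => Filter.Eventually.of_forall fun ω => by
      rw [Real.norm_eq_abs, abs_mul]
      refine mul_le_mul ?_ (abs_avg_le (fun _ => hh _) (hkφ j) _) (abs_nonneg _) (by norm_num)
      have h1 : |∫ ω, f (X a ω) ∂P| ≤ 1 := by
        have := norm_integral_le_of_norm_le_const (μ := P) (f := fun ω => f (X a ω)) (C := 1)
          (Filter.Eventually.of_forall fun ω => hf _)
        rwa [probReal_univ, mul_one] at this
      have h2 := abs_avg_le (g := fun y => f (D.map (inclEmb hak) y)) (fun _ => hf _) (hkφ j)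
        (X _ ω)
      exact (abs_sub _ _).trans (by linarith))
    (by
      filter_upwards [hlim] with ω hω
      have h0 : Filter.Tendsto (fun j => avg D k (fun y => f (D.map (inclEmb hak) y)) (φ j)
          (X _ ω) - ∫ ω, f (X a ω) ∂P) Filter.atTop (nhds 0) := by
        simpa using hω.sub_const (∫ ω, f (X a ω) ∂P)
      refine h0.zero_mul_isBoundedUnder_le (Filter.isBoundedUnder_of ⟨1, fun j => ?_⟩)
      exact abs_avg_le (fun _ => hh _) (hkφ j) _)
  have hb1 := tendsto_const_div_subseq (2 * 1 * 1 * a.card * b.card : ℝ) hφ.tendsto_atTop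
  have hb2 := (tendsto_zero_iff_abs_tendsto_zero _).2
    (squeeze_zero (fun j => abs_nonneg _) hprod hb1)
  have hsum := hb2.add hint
  have hconst : ∀ j, (∫ ω, f (X a ω) * h (X b ω) ∂P -
      ∫ ω, avg D k (fun y => f (D.map (inclEmb hak) y)) (φ j) (X _ ω) *
        avg D k (fun y => h (D.map (inclEmb hbk) y)) (φ j) (X _ ω) ∂P) +
      ∫ ω, (avg D k (fun y => f (D.map (inclEmb hak) y)) (φ j) (X _ ω) -
      ∫ ω, f (X a ω) ∂P) * avg D k (fun y => h (D.map (inclEmb hbk) y)) (φ j) (X _ ω) ∂P =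
      ∫ ω, f (X a ω) * h (X b ω) ∂P - (∫ ω, f (X a ω) ∂P) * ∫ ω, h (X b ω) ∂P := by
    intro j
    have mA := (measurable_avg (φ j) mf').comp (H.measurable _)
    have mB := (measurable_avg (φ j) mh').comp (H.measurable _)
    have bB := fun ω => abs_avg_le (g := fun y => h (D.map (inclEmb hbk) y)) (fun _ => hh _)
      (hkφ j) (X _ ω)
    have bA := fun ω => abs_avg_le (g := fun y => f (D.map (inclEmb hak) y)) (fun _ => hf _)
      (hkφ j) (X _ ω)
    have iB : Integrable (fun ω => avg D k (fun y => h (D.map (inclEmb hbk) y)) (φ j) (X _ ω)) P :=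
      Integrable.of_bound mB.aestronglyMeasurable 1 (Filter.Eventually.of_forall bB)
    have iAB : Integrable (fun ω => avg D k (fun y => f (D.map (inclEmb hak) y)) (φ j) (X _ ω) *
        avg D k (fun y => h (D.map (inclEmb hbk) y)) (φ j) (X _ ω)) P :=
      Integrable.of_bound (mA.mul mB).aestronglyMeasurable (1 * 1)
        (Filter.Eventually.of_forall fun ω => by
          rw [Real.norm_eq_abs, abs_mul]
          exact mul_le_mul (bA ω) (bB ω) (abs_nonneg _) zero_le_one)
    simp only [sub_mul]
    rw [integral_sub iAB (iB.const_mul _), integral_const_mul,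
      H.integral_avg mh' (fun _ => hh _) (hkφ j), eh]
    ring
  simp only [hconst, integral_zero, add_zero] at hsum
  exact sub_eq_zero.1 (tendsto_nhds_unique tendsto_const_nhds hsum)

end IsExchMeasurement

namespace IsExchMeasurement

variable {D : BDS} {Ω : Type} [MeasurableSpace Ω] {P : Measure Ω}
  {X : ∀ a : Finset ℕ, Ω → D.obj a} {k : ℕ} {g : D.obj (Finset.range k) → ℝ} {C : ℝ}

lemma integral_mul_map_shift_of_indepFun (hind : ∀ a b : Finset ℕ, Disjoint a b → IndepFun (X a) (X b) P)
    (H : IsExchMeasurement D P X) (mg : Measurable g)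
    {w : ↥(Finset.range k) ↪ ↥(Finset.range (2 * k))} (hw : ∀ i, (w i : ℕ) = k + i) :
    ∫ ω, g (X _ ω) * g (D.map w (X _ ω)) ∂P = (∫ ω, g (X _ ω) ∂P) ^ 2 := by
  have hsub : Finset.Ico k (2 * k) ⊆ Finset.range (2 * k) := fun i hi =>
    Finset.mem_range.2 (Finset.mem_Ico.1 hi).2
  let s : ↥(Finset.range k) ↪ ↥(Finset.Ico k (2 * k)) :=
    ⟨fun i => ⟨w i, Finset.mem_Ico.2 ⟨by rw [hw]; omega, Finset.mem_range.1 (w i).2⟩⟩,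
      fun i j hij => w.injective (Subtype.ext (Subtype.mk.inj hij))⟩
  have hs : w = s.trans (inclEmb hsub) := rfl
  have hdisj : Disjoint (Finset.range k) (Finset.Ico k (2 * k)) := by
    rw [Finset.disjoint_left]
    intro i hi hi'
    exact absurd (Finset.mem_range.1 hi) (not_lt.2 (Finset.mem_Ico.1 hi').1)
  have hcons := H.consistent _ _ hsub
  have h1 : ∫ ω, g (X _ ω) * g (D.map w (X _ ω)) ∂P =
      ∫ ω, g (X _ ω) * g (D.map s (X _ ω)) ∂P := by
    refine integral_congr_ae ?_
    filter_upwards [hcons] with ω hω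
    rw [hs, BDS.map_trans, hω]
  have h2 : ∫ ω, g (D.map s (X _ ω)) ∂P = ∫ ω, g (X _ ω) ∂P := by
    rw [← H.integral_map_emb (range_le (by omega : k ≤ 2 * k)) w mg]
    refine integral_congr_ae ?_
    filter_upwards [hcons] with ω hω
    rw [hs, BDS.map_trans, hω]
  have ms : Measurable fun y => g (D.map s y) := mg.comp (D.map_measurable s)
  rw [h1, (hind _ _ hdisj).integral_fun_comp_mul_comp (f := g) (g := fun y => g (D.map s y))
    (H.measurable _).aemeasurable (H.measurable _).aemeasurable mg.aestronglyMeasurable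
    ms.aestronglyMeasurable, h2, sq]

variable [IsProbabilityMeasure P]

/-- Under independence, the empirical averages concentrate around the expectation. -/
lemma integral_avg_sub_sq_le_of_indepFun
    (hind : ∀ a b : Finset ℕ, Disjoint a b → IndepFun (X a) (X b) P)
    (H : IsExchMeasurement D P X) (mg : Measurable g) (hg : ∀ y, |g y| ≤ C)
    {n : ℕ} (hn : 2 * k ≤ n) :
    ∫ ω, (avg D k g n (X _ ω) - ∫ ω, g (X _ ω) ∂P) ^ 2 ∂P ≤ 2 * C * C * k * k / n := by
  have hkn : k ≤ n := by omega
  obtain ⟨w, hw⟩ := range_disjoint_shift (k := k) le_rfl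
  have h1 := H.abs_integral_sub_integral_avg_mul_self_le mg hg hw hn
  rw [integral_mul_map_shift_of_indepFun hind H mg hw] at h1
  have hA : Measurable (avg D k g n) := measurable_avg n mg
  have bA := fun y => abs_avg_le (n := n) hg hkn y
  have iA : Integrable (fun ω => avg D k g n (X _ ω)) P :=
    integrable_comp (H.measurable _) hA bA
  have iAA : Integrable (fun ω => avg D k g n (X _ ω) * avg D k g n (X _ ω)) P :=
    integrable_comp (H.measurable _) (f := fun y => avg D k g n y * avg D k g n y) (hA.mul hA)
      (C := C * C) fun y => by
        rw [abs_mul]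
        exact mul_le_mul (bA y) (bA y) (abs_nonneg _) ((abs_nonneg _).trans (bA y))
  rw [integral_sub_sq iAA (integrable_const _) (iA.mul_const _), integral_const,
    integral_mul_const, H.integral_avg mg hg hkn, probReal_univ, one_smul]
  linarith [(abs_le.1 h1).1]

lemma exists_deterministic_of_indepFun
    (hind : ∀ a b : Finset ℕ, Disjoint a b → IndepFun (X a) (X b) P)
    (H : IsExchMeasurement D P X) {G : Set ((k : ℕ) × (D.obj (Finset.range k) → ℝ))}
    (hGc : G.Countable) (hG : ∀ g ∈ G, Measurable g.2 ∧ ∃ C : ℝ, ∀ d, |g.2 d| ≤ C) :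
    ∃ (m : ℕ → ℕ) (x : ∀ n : ℕ, D.obj (Finset.range (m n))),
      Filter.Tendsto m Filter.atTop Filter.atTop ∧
      ∀ g ∈ G, Filter.Tendsto (fun n => avg D g.1 g.2 (m n) (x n))
        Filter.atTop (nhds (∫ ω, g.2 (X (Finset.range g.1) ω) ∂P)) := by
  rcases G.eq_empty_or_nonempty with rfl | hne
  · obtain ⟨ω⟩ := P.nonempty_of_neZero
    exact ⟨id, fun n => X _ ω, Filter.tendsto_id, by simp⟩
  obtain ⟨e, he⟩ := hGc.exists_eq_range hne
  have heG : ∀ j, e j ∈ G := fun j => he ▸ Set.mem_range_self j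
  have me : ∀ j, Measurable (e j).2 := fun j => (hG _ (heG j)).1
  choose C hC using fun j => (hG _ (heG j)).2
  have key : ∀ n : ℕ, ∃ (m : ℕ) (x : D.obj (Finset.range m)), n ≤ m ∧ ∀ j ≤ n,
      |avg D (e j).1 (e j).2 m x - ∫ ω, (e j).2 (X _ ω) ∂P| ≤ 1 / ((n : ℝ) + 1) := by
    intro n
    set V : ℕ → ℕ → Ω → ℝ := fun j m ω =>
      (avg D (e j).1 (e j).2 m (X _ ω) - ∫ ω, (e j).2 (X _ ω) ∂P) ^ 2 with hV
    have hlim : Filter.Tendsto (fun m : ℕ => ∑ j ∈ Finset.range (n + 1),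
        2 * C j * C j * (e j).1 * (e j).1 / (m : ℝ)) Filter.atTop (nhds 0) := by
      simpa using tendsto_finsetSum (Finset.range (n + 1)) fun j _ =>
        tendsto_const_div_atTop_nhds_zero_nat (2 * C j * C j * (e j).1 * (e j).1)
    have hpos : (0 : ℝ) < (1 / ((n : ℝ) + 1)) ^ 2 := by positivity
    have hall : ∀ᶠ m : ℕ in Filter.atTop, ∀ j ∈ Finset.range (n + 1), 2 * (e j).1 ≤ m :=
      (Filter.eventually_all_finset _).2 fun j _ => Filter.eventually_ge_atTop _
    obtain ⟨m, hm1, hm2, hm3⟩ := ((hlim.eventually_lt_const hpos).and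
      (hall.and (Filter.eventually_ge_atTop n))).exists
    have mV : ∀ j, Measurable (V j m) := fun j =>
      (((measurable_avg m (me j)).comp (H.measurable _)).sub_const _).pow_const 2
    have iV : ∀ j ∈ Finset.range (n + 1), Integrable (V j m) P := by
      intro j hj
      refine Integrable.of_bound (mV j).aestronglyMeasurable
        ((C j + |∫ ω, (e j).2 (X _ ω) ∂P|) ^ 2) (Filter.Eventually.of_forall fun ω => ?_)
      rw [Real.norm_eq_abs, abs_pow]
      refine pow_le_pow_left₀ (abs_nonneg _) ((abs_sub _ _).trans ?_) 2
      have := abs_avg_le (n := m) (hC j) (by have := hm2 j hj; omega) (X _ ω)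
      linarith
    obtain ⟨ω, hω⟩ := exists_le_integral (integrable_finsetSum (Finset.range (n + 1)) iV)
    rw [integral_finsetSum _ iV] at hω
    refine ⟨m, X _ ω, hm3, fun j hj => ?_⟩
    have hj' : j ∈ Finset.range (n + 1) := Finset.mem_range.2 (Nat.lt_succ_of_le hj)
    have h1 : V j m ω ≤ ∑ j ∈ Finset.range (n + 1), V j m ω :=
      Finset.single_le_sum (f := fun j => V j m ω) (fun _ _ => sq_nonneg _) hj'
    have h2 : ∑ j ∈ Finset.range (n + 1), ∫ ω, V j m ω ∂P ≤
        ∑ j ∈ Finset.range (n + 1), 2 * C j * C j * (e j).1 * (e j).1 / (m : ℝ) :=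
      Finset.sum_le_sum fun i hi =>
        integral_avg_sub_sq_le_of_indepFun hind H (me i) (hC i) (hm2 i hi)
    refine abs_le_of_sq_le_sq ?_ (by positivity)
    exact h1.trans (hω.trans (h2.trans hm1.le))
  choose m x hm hx using key
  refine ⟨m, x, Filter.tendsto_atTop_mono hm Filter.tendsto_id, fun g hg => ?_⟩
  obtain ⟨j, rfl⟩ := he ▸ hg
  rw [tendsto_iff_norm_sub_tendsto_zero]
  refine squeeze_zero' (Filter.Eventually.of_forall fun _ => norm_nonneg _) ?_
    tendsto_one_div_add_atTop_nhds_zero_nat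
  filter_upwards [Filter.eventually_ge_atTop j] with n hn
  exact hx n j hn

lemma indepFun_of_exists_deterministic
    (hdet : ∀ G : Set ((k : ℕ) × (D.obj (Finset.range k) → ℝ)), G.Countable →
        (∀ g ∈ G, Measurable g.2 ∧ ∃ C : ℝ, ∀ d, |g.2 d| ≤ C) →
        ∃ (m : ℕ → ℕ) (x : ∀ n : ℕ, D.obj (Finset.range (m n))),
          Filter.Tendsto m Filter.atTop Filter.atTop ∧
          ∀ g ∈ G, Filter.Tendsto (fun n => avg D g.1 g.2 (m n) (x n))
            Filter.atTop (nhds (∫ ω, g.2 (X (Finset.range g.1) ω) ∂P)))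
    (H : IsExchMeasurement D P X) {a b : Finset ℕ} (hab : Disjoint a b) :
    IndepFun (X a) (X b) P := by
  refine indepFun_of_integral_indicator (H.measurable a) (H.measurable b) fun A B hA hB => ?_
  set f := A.indicator fun _ => (1 : ℝ)
  set h := B.indicator fun _ => (1 : ℝ)
  have mf : Measurable f := measurable_const.indicator hA
  have mh : Measurable h := measurable_const.indicator hB
  have hf : ∀ y, |f y| ≤ 1 := abs_indicator_one_le A
  have hh : ∀ y, |h y| ≤ 1 := abs_indicator_one_le B
  obtain ⟨k, hk⟩ := exists_subset_range (a ∪ b)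
  have hak := Finset.union_subset_left hk
  have hbk := Finset.union_subset_right hk
  set f' : D.obj (Finset.range k) → ℝ := fun y => f (D.map (inclEmb hak) y) with hf'
  set h' : D.obj (Finset.range k) → ℝ := fun y => h (D.map (inclEmb hbk) y) with hh'
  have mf' : Measurable f' := mf.comp (D.map_measurable _)
  have mh' : Measurable h' := mh.comp (D.map_measurable _)
  obtain ⟨m, x, hm, hx⟩ := hdet {⟨k, fun y => f' y * h' y⟩, ⟨k, f'⟩, ⟨k, h'⟩}
    (Set.toFinite _).countable (by
      rintro g (rfl | rfl | rfl)
      · refine ⟨mf'.mul mh', 1 * 1, fun y => ?_⟩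
        rw [abs_mul]
        exact mul_le_mul (hf _) (hh _) (abs_nonneg _) zero_le_one
      · exact ⟨mf', 1, fun y => hf _⟩
      · exact ⟨mh', 1, fun y => hh _⟩)
  have h1 := hx ⟨k, fun y => f' y * h' y⟩ (by simp)
  have h2 := hx ⟨k, f'⟩ (by simp)
  have h3 := hx ⟨k, h'⟩ (by simp)
  dsimp only at h1 h2 h3
  have e1 : ∫ ω, f' (X _ ω) * h' (X _ ω) ∂P = ∫ ω, f (X a ω) * h (X b ω) ∂P := by
    refine integral_congr_ae ?_
    filter_upwards [H.consistent _ _ hak, H.consistent _ _ hbk] with ω h1 h2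
    simp only [hf', hh', h1, h2]
  rw [e1] at h1
  rw [H.integral_map_emb hak (inclEmb hak) mf] at h2
  rw [H.integral_map_emb hbk (inclEmb hbk) mh] at h3
  have hzero : Filter.Tendsto (fun n => avg D k (fun y => f' y * h' y) (m n) (x n) -
      avg D k f' (m n) (x n) * avg D k h' (m n) (x n)) Filter.atTop (nhds 0) := by
    rw [tendsto_zero_iff_abs_tendsto_zero]
    refine squeeze_zero' (Filter.Eventually.of_forall fun _ => abs_nonneg _) ?_
      (tendsto_const_div_subseq (2 * 1 * 1 * a.card * b.card : ℝ) hm)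
    filter_upwards [hm.eventually_ge_atTop k] with n hn
    have hkj := range_le hn
    have := abs_embMean_mul_sub_le hf hh ((inclEmb hak).trans (inclEmb hkj))
      ((inclEmb hbk).trans (inclEmb hkj)) (fun i i' hii =>
        Finset.disjoint_left.1 hab i.2 (by
          have h' : (i : ℕ) = i' := congrArg Subtype.val hii
          rw [h']; exact i'.2)) (x n)
    rw [Finset.card_range] at this
    have e2 : embMean D (fun y => f (D.map (inclEmb hak) y) * h (D.map (inclEmb hbk) y))
        (inclEmb hkj) (x n) = permMean fun π : Equiv.Perm ↥(Finset.range (m n)) =>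
          f (D.map ((inclEmb hak).trans (inclEmb hkj)) (D.map π.toEmbedding (x n))) *
            h (D.map ((inclEmb hbk).trans (inclEmb hkj)) (D.map π.toEmbedding (x n))) := by
      simp only [embMean, BDS.map_trans]
    simp only [Function.comp_apply, avg_eq_embMean D _ (inclEmb hkj), hf', hh',
      embMean_comp_map]
    rwa [e2]
  have hlim := h1.sub (h2.mul h3)
  exact sub_eq_zero.1 (tendsto_nhds_unique hlim hzero)

end IsExchMeasurement

/-- Laws on the full product are determined by their finite-dimensional restrictions. -/
lemma map_eq_map_of_forall_restrict {Ω ι : Type*} [MeasurableSpace Ω] {E : ι → Type*}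
    [∀ i, MeasurableSpace (E i)] {P Q : Measure Ω} [IsFiniteMeasure Q]
    {Y Z : Ω → ∀ i, E i} (hY : Measurable Y) (hZ : Measurable Z)
    (h : ∀ I : Finset ι, P.map (fun ω => I.restrict (Y ω)) = Q.map (fun ω => I.restrict (Z ω))) :
    P.map Y = Q.map Z := by
  refine IsProjectiveLimit.unique (P := fun I => (Q.map Z).map I.restrict) (fun I => ?_)
    fun _ => rfl
  have hI : Measurable (I.restrict (π := E)) := Finset.measurable_restrict I
  dsimp only
  rw [Measure.map_map hI hY, Measure.map_map hI hZ]
  exact h I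

lemma exists_forall_subset_range (I : Finset (Finset ℕ)) :
    ∃ N, ∀ n, N ≤ n → ∀ b ∈ I, b ⊆ Finset.range n := by
  obtain ⟨N, hN⟩ := exists_subset_range (I.biUnion id)
  exact ⟨N, fun n hn b hb =>
    ((Finset.subset_biUnion_of_mem id hb).trans hN).trans (Finset.range_subset_range.2 hn)⟩

lemma measurable_pi_map_inclEmb (D : BDS) {c : Finset ℕ} {I : Finset (Finset ℕ)}
    (hI : ∀ b ∈ I, b ⊆ c) :
    Measurable fun (y : D.obj c) (b : I) => D.map (inclEmb (hI b b.2)) y :=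
  measurable_pi_lambda _ fun _ => D.map_measurable _

/-- On consistent families the action of a permutation preserving `b ⊆ c` can be computed
from the `c`-th component. -/
lemma permAct_apply_of_mem_limitSet {D : BDS} {π : Equiv.Perm ℕ} {x : ∀ a : Finset ℕ, D.obj a}
    (hx : x ∈ limitSet D) {b c : Finset ℕ} (hbc : b ⊆ c) {ρ : Equiv.Perm ↥c}
    (hρ : ∀ i, (ρ i : ℕ) = π i) :
    permAct D π x b = D.map (inclEmb hbc) (D.map ρ.toEmbedding (x c)) := by
  have hsub : b.image π ⊆ c := by
    intro j hj
    obtain ⟨i, hi, rfl⟩ := Finset.mem_image.1 hj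
    rw [← hρ ⟨i, hbc hi⟩]
    exact (ρ _).2
  rw [permAct, ← hx hsub, ← BDS.map_trans, ← BDS.map_trans]
  congr 1
  ext i
  exact (hρ ⟨i, hbc i.2⟩).symm

namespace IsExchMeasurement

variable {D : BDS} {Ω : Type} [MeasurableSpace Ω] {P : Measure Ω}
  {X : ∀ a : Finset ℕ, Ω → D.obj a} {k : ℕ} {g : D.obj (Finset.range k) → ℝ} {C : ℝ}

lemma measurable_pi (H : IsExchMeasurement D P X) : Measurable fun ω a => X a ω :=
  measurable_pi_lambda _ H.measurable

lemma ae_mem_limitSet (H : IsExchMeasurement D P X) :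
    ∀ᵐ ω ∂P, (fun a => X a ω) ∈ limitSet D :=
  ae_all_iff.2 fun b => ae_all_iff.2 fun a => ae_all_iff.2 fun h => H.consistent b a h

variable [IsProbabilityMeasure P]

/-- The law on the projective limit is invariant under finite permutations. -/
lemma map_permAct (H : IsExchMeasurement D P X) {π : Equiv.Perm ℕ}
    (hπ : ({i : ℕ | π i ≠ i}).Finite) :
    P.map (fun ω => permAct D π fun a => X a ω) = P.map fun ω a => X a ω := by
  refine map_eq_map_of_forall_restrict ((measurable_permAct D π).comp H.measurable_pi)
    H.measurable_pi fun I => ?_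
  obtain ⟨N, hN⟩ := exists_forall_perm_lt_iff hπ
  obtain ⟨N', hN'⟩ := exists_forall_subset_range I
  set n := max N N'
  have hI := hN' n (le_max_right _ _)
  let ρ : Equiv.Perm ↥(Finset.range n) := π.subtypePerm fun i => by
    simpa using hN n (le_max_left _ _) i
  have mΦ := measurable_pi_map_inclEmb D hI
  have h1 : (fun ω => I.restrict (permAct D π fun a => X a ω)) =ᵐ[P]
      (fun y (b : I) => D.map (inclEmb (hI b b.2)) y) ∘
        fun ω => D.map ρ.toEmbedding (X _ ω) := by
    filter_upwards [H.ae_mem_limitSet] with ω hω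
    funext b
    exact permAct_apply_of_mem_limitSet hω (hI b b.2) fun i => rfl
  have h2 : (fun ω => I.restrict fun a => X a ω) =ᵐ[P]
      (fun y (b : I) => D.map (inclEmb (hI b b.2)) y) ∘ fun ω => X _ ω := by
    filter_upwards [H.ae_mem_limitSet] with ω hω
    funext b
    exact (hω (hI b b.2)).symm
  rw [Measure.map_congr h1, Measure.map_congr h2, ← Measure.map_map mΦ (H.measurable_map _),
    ← Measure.map_map mΦ (H.measurable _)]
  exact congrArg _ (H.exchangeable _ ρ)

lemma integral_indicator_mul_map_emb (H : IsExchMeasurement D P X)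
    {M : Set (∀ a : Finset ℕ, D.obj a)} (hM : MeasurableSet M)
    (hinv : ∀ π : Equiv.Perm ℕ, ({i : ℕ | π i ≠ i}).Finite →
      ∀ x ∈ limitSet D, (permAct D π x ∈ M ↔ x ∈ M))
    (mg : Measurable g) {c : Finset ℕ} (hc : Finset.range k ⊆ c) (τ : ↥(Finset.range k) ↪ ↥c) :
    ∫ ω, M.indicator (fun _ => (1 : ℝ)) (fun a => X a ω) * g (D.map τ (X c ω)) ∂P =
      ∫ ω, M.indicator (fun _ => (1 : ℝ)) (fun a => X a ω) * g (X _ ω) ∂P := by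
  obtain ⟨ρ, rfl⟩ := exists_perm_trans_eq (inclEmb hc) τ
  set π : Equiv.Perm ℕ := Equiv.Perm.ofSubtype ρ with hπdef
  have hρ : ∀ i, (ρ i : ℕ) = π i := fun i => (Equiv.Perm.ofSubtype_apply_coe ρ i).symm
  have hπ : ({i : ℕ | π i ≠ i}).Finite := by
    refine c.finite_toSet.subset fun i hi => ?_
    by_contra hic
    exact hi (Equiv.Perm.ofSubtype_apply_of_not_mem ρ hic)
  set F : (∀ a : Finset ℕ, D.obj a) → ℝ := fun x =>
    M.indicator (fun _ => (1 : ℝ)) x * g (x _) with hF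
  have mF : Measurable F :=
    (measurable_const.indicator hM).mul (mg.comp (measurable_pi_apply _))
  have h1 : ∫ ω, F (permAct D π fun a => X a ω) ∂P = ∫ ω, F (fun a => X a ω) ∂P := by
    rw [← integral_map (φ := fun ω => permAct D π fun a => X a ω)
      ((measurable_permAct D π).comp H.measurable_pi).aemeasurable mF.aestronglyMeasurable,
      H.map_permAct hπ, integral_map H.measurable_pi.aemeasurable mF.aestronglyMeasurable]
  rw [← h1]
  refine integral_congr_ae ?_
  filter_upwards [H.ae_mem_limitSet] with ω hω
  have h2 : M.indicator (fun _ => (1 : ℝ)) (permAct D π fun a => X a ω) =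
      M.indicator (fun _ => (1 : ℝ)) fun a => X a ω := by
    by_cases h : (fun a => X a ω) ∈ M
    · rw [Set.indicator_of_mem h, Set.indicator_of_mem ((hinv π hπ _ hω).2 h)]
    · rw [Set.indicator_of_notMem h, Set.indicator_of_notMem fun h' => h ((hinv π hπ _ hω).1 h')]
  simp only [hF]
  rw [h2, permAct_apply_of_mem_limitSet hω hc hρ, BDS.map_trans]

lemma integral_indicator_mul_avg (H : IsExchMeasurement D P X)
    {M : Set (∀ a : Finset ℕ, D.obj a)} (hM : MeasurableSet M)
    (hinv : ∀ π : Equiv.Perm ℕ, ({i : ℕ | π i ≠ i}).Finite →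
      ∀ x ∈ limitSet D, (permAct D π x ∈ M ↔ x ∈ M))
    (mg : Measurable g) (hg : ∀ y, |g y| ≤ C) {n : ℕ} (hn : k ≤ n) :
    ∫ ω, M.indicator (fun _ => (1 : ℝ)) (fun a => X a ω) * avg D k g n (X _ ω) ∂P =
      ∫ ω, M.indicator (fun _ => (1 : ℝ)) (fun a => X a ω) * g (X _ ω) ∂P := by
  have hint : ∀ τ : ↥(Finset.range k) ↪ ↥(Finset.range n), Integrable (fun ω =>
      M.indicator (fun _ => (1 : ℝ)) (fun a => X a ω) * g (D.map τ (X _ ω))) P := fun τ => by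
    refine Integrable.of_bound (((measurable_const.indicator hM).comp H.measurable_pi).mul
      (mg.comp (H.measurable_map τ))).aestronglyMeasurable (1 * C)
      (Filter.Eventually.of_forall fun ω => ?_)
    rw [Real.norm_eq_abs, abs_mul]
    exact mul_le_mul (abs_indicator_one_le M _) (hg _) (abs_nonneg _) zero_le_one
  simp only [avg_eq_embMean D g (inclEmb (range_le hn)), embMean, permMean, Finset.mul_sum,
    mul_left_comm (M.indicator _ _)]
  rw [integral_finsetSum _ fun π _ => (hint _).const_mul _]
  simp only [integral_const_mul, H.integral_indicator_mul_map_emb hM hinv mg (range_le hn)]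
  rw [← Finset.mul_sum]
  exact permMean_const (V := ↥(Finset.range n)) _

lemma integral_indicator_mul_eq_of_indepFun
    (hind : ∀ a b : Finset ℕ, Disjoint a b → IndepFun (X a) (X b) P)
    (H : IsExchMeasurement D P X)
    {M : Set (∀ a : Finset ℕ, D.obj a)} (hM : MeasurableSet M)
    (hinv : ∀ π : Equiv.Perm ℕ, ({i : ℕ | π i ≠ i}).Finite →
      ∀ x ∈ limitSet D, (permAct D π x ∈ M ↔ x ∈ M))
    (mg : Measurable g) (hg : ∀ y, |g y| ≤ C) :
    ∫ ω, M.indicator (fun _ => (1 : ℝ)) (fun a => X a ω) * g (X _ ω) ∂P =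
      (∫ ω, M.indicator (fun _ => (1 : ℝ)) (fun a => X a ω) ∂P) * ∫ ω, g (X _ ω) ∂P := by
  set E := ∫ ω, g (X _ ω) ∂P with hE
  set J : Ω → ℝ := fun ω => M.indicator (fun _ => (1 : ℝ)) fun a => X a ω
  have mJ : Measurable J := (measurable_const.indicator hM).comp H.measurable_pi
  have bJ : ∀ ω, |J ω| ≤ 1 := fun ω => abs_indicator_one_le M _
  set δ := ∫ ω, J ω * g (X _ ω) ∂P - (∫ ω, J ω ∂P) * E with hδ
  have key : ∀ n, 2 * k ≤ n → δ ^ 2 ≤ 2 * C * C * k * k / n := by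
    intro n hn
    have hkn : k ≤ n := by omega
    refine le_trans ?_ (integral_avg_sub_sq_le_of_indepFun hind H mg hg hn)
    have mA : Measurable fun ω => avg D k g n (X _ ω) := (measurable_avg n mg).comp (H.measurable _)
    set V : Ω → ℝ := fun ω => avg D k g n (X _ ω) - E
    have mV : Measurable V := mA.sub_const E
    have bV : ∀ ω, |V ω| ≤ C + |E| := fun ω =>
      (abs_sub _ _).trans (add_le_add_left (abs_avg_le hg hkn _) _)
    have bJV : ∀ ω, |J ω * V ω| ≤ 1 * (C + |E|) := fun ω => by
      rw [abs_mul]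
      exact mul_le_mul (bJ ω) (bV ω) (abs_nonneg _) zero_le_one
    have lJV : MemLp (fun ω => J ω * V ω) 2 P :=
      MemLp.of_bound (mJ.mul mV).aestronglyMeasurable _ (Filter.Eventually.of_forall bJV)
    have lV : MemLp V 2 P :=
      MemLp.of_bound mV.aestronglyMeasurable _ (Filter.Eventually.of_forall bV)
    have iJ : Integrable J P :=
      Integrable.of_bound mJ.aestronglyMeasurable 1 (Filter.Eventually.of_forall bJ)
    have iJA : Integrable (fun ω => J ω * avg D k g n (X _ ω)) P :=
      Integrable.of_bound (mJ.mul mA).aestronglyMeasurable (1 * C)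
        (Filter.Eventually.of_forall fun ω => by
          rw [Real.norm_eq_abs, abs_mul]
          exact mul_le_mul (bJ ω) (abs_avg_le hg hkn _) (abs_nonneg _) zero_le_one)
    have h1 : ∫ ω, J ω * V ω ∂P = δ := by
      simp only [V, mul_sub]
      rw [integral_sub iJA (iJ.mul_const E), integral_mul_const,
        H.integral_indicator_mul_avg hM hinv mg hg hkn]
    have h2 := variance_nonneg (fun ω => J ω * V ω) P
    rw [variance_eq_sub lJV, h1] at h2
    refine (sub_nonneg.1 h2).trans (integral_mono lJV.integrable_sq lV.integrable_sq fun ω => ?_)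
    simp only [Pi.pow_apply, mul_pow]
    exact mul_le_of_le_one_left (sq_nonneg _) ((sq_le_one_iff_abs_le_one _).2 (bJ ω))
  have h0 : δ ^ 2 ≤ 0 := ge_of_tendsto
    (tendsto_const_div_atTop_nhds_zero_nat (2 * C * C * k * k))
    ((Filter.eventually_ge_atTop (2 * k)).mono key)
  exact sub_eq_zero.1 (pow_eq_zero_iff two_ne_zero |>.1 (le_antisymm h0 (sq_nonneg δ)))

lemma ergodic_of_indepFun
    (hind : ∀ a b : Finset ℕ, Disjoint a b → IndepFun (X a) (X b) P)
    (H : IsExchMeasurement D P X)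
    {M : Set (∀ a : Finset ℕ, D.obj a)} (hM : MeasurableSet M)
    (hinv : ∀ π : Equiv.Perm ℕ, ({i : ℕ | π i ≠ i}).Finite →
      ∀ x ∈ limitSet D, (permAct D π x ∈ M ↔ x ∈ M)) :
    P ((fun ω => fun a => X a ω) ⁻¹' M) = 0 ∨ P ((fun ω => fun a => X a ω) ⁻¹' M) = 1 := by
  set S := (fun ω => fun a => X a ω) ⁻¹' M
  have hS : MeasurableSet S := H.measurable_pi hM
  have hrange : ∀ n, (P.restrict S).map (X (Finset.range n)) =
      (P S • P).map (X (Finset.range n)) := by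
    intro n
    ext A hA
    rw [Measure.map_apply (H.measurable _) hA, Measure.map_apply (H.measurable _) hA,
      Measure.restrict_apply (H.measurable _ hA), Set.inter_comm, Measure.smul_apply,
      smul_eq_mul]
    exact measure_inter_preimage_eq_mul_of_integral_indicator H.measurable_pi (H.measurable _)
      hM hA (integral_indicator_mul_eq_of_indepFun hind H hM hinv (measurable_const.indicator hA)
        (abs_indicator_one_le A))
  have hfin : IsFiniteMeasure (P S • P) := P.smul_finite (measure_ne_top P S)
  have hlaw : (P.restrict S).map (fun ω a => X a ω) = (P S • P).map fun ω a => X a ω := by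
    refine map_eq_map_of_forall_restrict H.measurable_pi H.measurable_pi fun I => ?_
    obtain ⟨n, hn⟩ := exists_forall_subset_range I
    have hI := hn n le_rfl
    have mΦ := measurable_pi_map_inclEmb D hI
    have h2 : (fun ω => I.restrict fun a => X a ω) =ᵐ[P]
        (fun y (b : I) => D.map (inclEmb (hI b b.2)) y) ∘ fun ω => X _ ω := by
      filter_upwards [H.ae_mem_limitSet] with ω hω
      funext b
      exact (hω (hI b b.2)).symm
    rw [Measure.map_congr (ae_mono Measure.restrict_le_self h2),
      Measure.map_congr (Measure.smul_absolutelyContinuous.ae_le h2),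
      ← Measure.map_map mΦ (H.measurable _), ← Measure.map_map mΦ (H.measurable _), hrange n]
  have hp : P S = P S * P S := by
    have := congrArg (fun μ => μ M) hlaw
    simpa only [Measure.map_apply H.measurable_pi hM, Measure.restrict_apply hS, Set.inter_self,
      Measure.smul_apply, smul_eq_mul, S] using this
  by_cases h0 : P S = 0
  · exact Or.inl h0
  · refine Or.inr ?_
    exact ((ENNReal.mul_eq_left h0 (measure_ne_top P S)).1 hp.symm)

end IsExchMeasurement

/-- For an exchangeable `D`-measurement the following are equivalent:
(i) ergodicity with respect to finite permutations of `ℕ`,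
(ii) independence of the measurements on disjoint finite sets,
(iii) approximability of all expectations of (countably many) bounded kernels by
empirical averages along a single deterministic sequence. -/
theorem ergodic_iff_independence_iff_deterministic_averages
    (D : BDS) {Ω : Type} [MeasurableSpace Ω] (P : Measure Ω) [IsProbabilityMeasure P]
    (X : ∀ a : Finset ℕ, Ω → D.obj a) (hX : ∀ a, Measurable (X a))
    -- sampling consistency
    (hconsist : ∀ (b a : Finset ℕ) (h : b ⊆ a),
      ∀ᵐ ω ∂P, D.map (inclEmb h) (X a ω) = X b ω)
    -- exchangeability
    (hexch : ∀ (a : Finset ℕ) (π : ↥a ≃ ↥a),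
      Measure.map (fun ω => D.map π.toEmbedding (X a ω)) P = Measure.map (X a) P) :
    ((∀ M : Set (∀ a : Finset ℕ, D.obj a), MeasurableSet M →
        (∀ π : Equiv.Perm ℕ, ({i : ℕ | π i ≠ i}).Finite →
          ∀ x ∈ limitSet D, (permAct D π x ∈ M ↔ x ∈ M)) →
        P ((fun ω => fun a => X a ω) ⁻¹' M) = 0 ∨
          P ((fun ω => fun a => X a ω) ⁻¹' M) = 1) ↔
      (∀ a b : Finset ℕ, Disjoint a b → IndepFun (X a) (X b) P)) ∧
    ((∀ a b : Finset ℕ, Disjoint a b → IndepFun (X a) (X b) P) ↔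
      (∀ G : Set ((k : ℕ) × (D.obj (Finset.range k) → ℝ)), G.Countable →
        (∀ g ∈ G, Measurable g.2 ∧ ∃ C : ℝ, ∀ d, |g.2 d| ≤ C) →
        ∃ (m : ℕ → ℕ) (x : ∀ n : ℕ, D.obj (Finset.range (m n))),
          Filter.Tendsto m Filter.atTop Filter.atTop ∧
          ∀ g ∈ G, Filter.Tendsto (fun n => avg D g.1 g.2 (m n) (x n))
            Filter.atTop (nhds (∫ ω, g.2 (X (Finset.range g.1) ω) ∂P)))) := by
  have H : IsExchMeasurement D P X := ⟨hX, hconsist, hexch⟩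
  exact ⟨⟨fun herg _ _ hab => IsExchMeasurement.indepFun_of_ergodic herg H hab,
      fun hind _ hM hinv => IsExchMeasurement.ergodic_of_indepFun hind H hM hinv⟩,
    ⟨fun hind _ hGc hG => IsExchMeasurement.exists_deterministic_of_indepFun hind H hGc hG,
      fun hdet _ _ hab => IsExchMeasurement.indepFun_of_exists_deterministic hdet H hab⟩⟩
end

section
/- Generalized de Finetti theorem: let D be a Borel data structure over ℕ with SYM(D) ≠ ∅. Then eSYM(D), the set of exchangeable laws on D with the independence property, is a non-empty measurable subset of SYM(D) (identified with the Borel space of exchangeable laws of D-measurements using IDs ℕ), and the map from probability measures Ξ on eSYM(D) to SYM(D), sending Ξ to the rule E[Ξ] with E[Ξ]_a(·) = ∫_{eSYM(D)} μ_a(·) dΞ(μ) for every finite a ⊆ ℕ, is a bijection. -/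
open MeasureTheory ProbabilityTheory

/-- A probability measure `Q` on `∏_a D_a` is sampling-consistent if the
restriction maps agree `Q`-almost surely. -/
def jointConsistent (D : BDS) (Q : Measure (∀ a : Finset ℕ, D.obj a)) : Prop :=
  ∀ (b a : Finset ℕ) (h : b ⊆ a), ∀ᵐ x ∂Q, D.map (inclEmb h) (x a) = x b

/-- A probability measure `Q` on `∏_a D_a` is exchangeable if each marginal is
invariant under all relabelings of its base set. -/
def jointExchangeable (D : BDS) (Q : Measure (∀ a : Finset ℕ, D.obj a)) : Prop :=
  ∀ (a : Finset ℕ) (π : ↥a ≃ ↥a),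
    Measure.map (fun x => D.map π.toEmbedding (x a)) Q = Measure.map (fun x => x a) Q

/-- `SYM(D)`, identified with the laws of exchangeable `D`-measurements using IDs `ℕ`. -/
def SYMset (D : BDS) : Set (Measure (∀ a : Finset ℕ, D.obj a)) :=
  {Q | IsProbabilityMeasure Q ∧ jointConsistent D Q ∧ jointExchangeable D Q}

/-- The independence property: measurements on disjoint finite sets are independent. -/
def indepProperty (D : BDS) (Q : Measure (∀ a : Finset ℕ, D.obj a)) : Prop :=
  ∀ a b : Finset ℕ, Disjoint a b →
    Measure.map (fun x => (x a, x b)) Q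
      = (Measure.map (fun x => x a) Q).prod (Measure.map (fun x => x b) Q)

/-- `eSYM(D)`: the exchangeable laws with the independence property. -/
def eSYMset (D : BDS) : Set (Measure (∀ a : Finset ℕ, D.obj a)) :=
  {Q ∈ SYMset D | indepProperty D Q}

namespace BDS

attribute [fun_prop] BDS.map_measurable

variable (D : BDS)

/-- The restriction of an injection of `ℕ` to a finite set, as an embedding onto its image. -/
def embMap (ρ : ℕ ↪ ℕ) (a : Finset ℕ) : ↥a ↪ ↥(a.map ρ) :=
  ⟨fun i => ⟨ρ i, Finset.mem_map_of_mem ρ i.2⟩, fun _ _ hij =>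
    Subtype.ext (ρ.injective (congrArg Subtype.val hij))⟩

/-- The action of an injection of `ℕ` on families of measurements. -/
def reindex (ρ : ℕ ↪ ℕ) (x : ∀ a : Finset ℕ, D.obj a) (a : Finset ℕ) : D.obj a :=
  D.map (embMap ρ a) (x (a.map ρ))

@[fun_prop]
lemma measurable_reindex (ρ : ℕ ↪ ℕ) : Measurable (D.reindex ρ) :=
  measurable_pi_lambda _ fun _ => (D.map_measurable _).comp (measurable_pi_apply _)

lemma map_map {c b a : Finset ℕ} (σ : ↥c ↪ ↥b) (τ : ↥b ↪ ↥a) (x : D.obj a) :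
    D.map σ (D.map τ x) = D.map (σ.trans τ) x := by
  rw [D.map_comp]; rfl

lemma reindex_eq_map {ρ : ℕ ↪ ℕ} {a c : Finset ℕ} (h : a.map ρ = c) (τ : ↥a ↪ ↥c)
    (hτ : ∀ i, (τ i : ℕ) = ρ i) (x : ∀ a : Finset ℕ, D.obj a) :
    D.reindex ρ x a = D.map τ (x c) := by
  subst h
  have : τ = embMap ρ a := by
    ext i
    exact hτ i
  rw [this, reindex]

lemma reindex_congr {ρ ρ' : ℕ ↪ ℕ} {a : Finset ℕ} (h : ∀ i ∈ a, ρ i = ρ' i)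
    (x : ∀ a : Finset ℕ, D.obj a) : D.reindex ρ x a = D.reindex ρ' x a := by
  have hmap : a.map ρ = a.map ρ' := by
    ext j
    simp only [Finset.mem_map]
    exact exists_congr fun i => and_congr_right fun hi => by rw [h i hi]
  rw [D.reindex_eq_map hmap ((embMap ρ a).trans (inclEmb hmap.subset)) fun i => rfl,
    D.reindex_eq_map rfl ((embMap ρ a).trans (inclEmb hmap.subset)) fun i => h i i.2]

lemma reindex_reindex (σ ρ : ℕ ↪ ℕ) (x : ∀ a : Finset ℕ, D.obj a) :
    D.reindex σ (D.reindex ρ x) = D.reindex (σ.trans ρ) x := by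
  funext a
  rw [D.reindex_eq_map (Finset.map_map σ ρ a).symm ((embMap σ a).trans (embMap ρ _)) fun i => rfl,
    ← map_map]
  rfl

/-- All restrictions of a measurement on `c` to the members of a finite family of subsets of
`c`. -/
def restrictFamily {I : Finset (Finset ℕ)} {c : Finset ℕ} (h : ∀ a ∈ I, a ⊆ c) (y : D.obj c)
    (a : I) : D.obj a :=
  D.map (inclEmb (h a a.2)) y

lemma measurable_restrictFamily {I : Finset (Finset ℕ)} {c : Finset ℕ} (h : ∀ a ∈ I, a ⊆ c) :
    Measurable (D.restrictFamily h) :=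
  measurable_pi_lambda _ fun _ => D.map_measurable _

variable {D} {Q : Measure (∀ a : Finset ℕ, D.obj a)}

lemma restrictFamily_ae_eq (hQ : jointConsistent D Q) {I : Finset (Finset ℕ)} {c : Finset ℕ}
    (h : ∀ a ∈ I, a ⊆ c) : ∀ᵐ x ∂Q, D.restrictFamily h (x c) = I.restrict x := by
  have : ∀ᵐ x ∂Q, ∀ a : I, D.map (inclEmb (h a a.2)) (x c) = x a :=
    ae_all_iff.2 fun a => hQ _ _ _
  filter_upwards [this] with x hx
  exact funext hx

/-- A consistent law is determined by its marginals. -/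
lemma eq_of_map_eval_eq {P : Measure (∀ a : Finset ℕ, D.obj a)} [IsFiniteMeasure P]
    (hP : jointConsistent D P) (hQ : jointConsistent D Q)
    (h : ∀ a, P.map (fun x => x a) = Q.map (fun x => x a)) : P = Q := by
  have key : ∀ (R : Measure (∀ a : Finset ℕ, D.obj a)), jointConsistent D R →
      ∀ I : Finset (Finset ℕ), R.map I.restrict =
        (R.map fun x => x (I.sup id)).map
          (D.restrictFamily fun a ha => Finset.le_sup (f := id) ha) := by
    intro R hR I
    rw [Measure.map_map (D.measurable_restrictFamily _) (measurable_pi_apply _)]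
    refine Measure.map_congr ?_
    filter_upwards [restrictFamily_ae_eq hR fun a ha => Finset.le_sup (f := id) ha] with x hx
    exact hx.symm
  refine IsProjectiveLimit.unique (P := fun I => P.map I.restrict) (fun I => rfl) fun I => ?_
  change _ = P.map I.restrict
  rw [key Q hQ, key P hP, h]

/-- Exchangeable laws are invariant under all injections between finite sets. -/
lemma map_map_eval (hc : jointConsistent D Q) (he : jointExchangeable D Q) {b a : Finset ℕ}
    (τ : ↥b ↪ ↥a) : Q.map (fun x => D.map τ (x a)) = Q.map (fun x => x b) := by
  classical
  have ha : a ⊆ a ∪ b := Finset.subset_union_left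
  have hb : b ⊆ a ∪ b := Finset.subset_union_right
  obtain ⟨π, hπ⟩ : ∃ π : ↥(a ∪ b) ≃ ↥(a ∪ b),
      (inclEmb hb).trans π.toEmbedding = τ.trans (inclEmb ha) := by
    let f : ↥(a ∪ b) → ℕ := fun i => if h : (i : ℕ) ∈ b then τ ⟨i, h⟩ else 0
    have hf : ∀ (i : ↥(a ∪ b)) (h : (i : ℕ) ∈ b), f i = τ ⟨i, h⟩ := fun i h => dif_pos h
    obtain ⟨π, hπ⟩ := Finset.exists_equiv_extend_of_card_eq (t := a ∪ b) (by simp)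
      (s := Finset.univ.filter fun i : ↥(a ∪ b) => (i : ℕ) ∈ b) (f := f) (by
        intro j hj
        obtain ⟨i, hi, rfl⟩ := Finset.mem_image.1 hj
        rw [hf i (by simpa using hi)]
        exact ha (τ _).2) (by
        intro i hi j hj hij
        rw [hf i (by simpa using hi), hf j (by simpa using hj)] at hij
        exact Subtype.ext (Subtype.mk.inj (τ.injective (Subtype.ext hij))))
    refine ⟨π, ?_⟩
    ext i
    have := hπ (inclEmb hb i) (Finset.mem_filter.2 ⟨Finset.mem_univ _, i.2⟩)
    rw [hf _ i.2] at this
    exact this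
  calc Q.map (fun x => D.map τ (x a))
      = Q.map (fun x => D.map (inclEmb hb) (D.map π.toEmbedding (x (a ∪ b)))) := by
        refine Measure.map_congr ?_
        filter_upwards [hc a _ ha] with x hx
        rw [← hx, map_map, map_map, hπ]
    _ = (Q.map (fun x => D.map π.toEmbedding (x (a ∪ b)))).map (D.map (inclEmb hb)) := by
        rw [Measure.map_map (by fun_prop) (by fun_prop)]; rfl
    _ = Q.map (fun x => D.map (inclEmb hb) (x (a ∪ b))) := by
        rw [he, Measure.map_map (by fun_prop) (by fun_prop)]; rfl
    _ = Q.map (fun x => x b) := Measure.map_congr (hc b _ hb)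

/-- Exchangeable laws are invariant under reindexing. -/
lemma measurePreserving_reindex (hQ : Q ∈ SYMset D) (ρ : ℕ ↪ ℕ) :
    MeasurePreserving (D.reindex ρ) Q Q := by
  obtain ⟨hp, hc, he⟩ := hQ
  refine ⟨by fun_prop, ?_⟩
  refine eq_of_map_eval_eq ?_ hc fun a => ?_
  · intro b a h
    refine (ae_map_iff (by fun_prop)
      (measurableSet_eq_fun (by fun_prop) (by fun_prop))).2 ?_
    filter_upwards [hc (b.map ρ) (a.map ρ) (Finset.map_subset_map.2 h)] with x hx
    rw [reindex, reindex, ← hx, map_map, map_map]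
    rfl
  · rw [Measure.map_map (by fun_prop) (by fun_prop)]
    exact map_map_eval hc he _

lemma indepFun_reindex (hQ : Q ∈ eSYMset D) {ρ σ : ℕ ↪ ℕ} (h : ∀ i j, ρ i ≠ σ j) :
    IndepFun (D.reindex ρ) (D.reindex σ) Q := by
  have hp := hQ.1.1
  have hsup : ∀ I : Finset (Finset ℕ), ∀ a ∈ I, a ⊆ I.sup id :=
    fun I a ha => Finset.le_sup (f := id) ha
  have hae : ∀ (ρ : ℕ ↪ ℕ) (I : Finset (Finset ℕ)), ∀ᵐ x ∂Q,
      D.restrictFamily (hsup I)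
        (D.map (embMap ρ (I.sup id)) (x ((I.sup id).map ρ))) = fun a : I => D.reindex ρ x a :=
    fun ρ I => (measurePreserving_reindex hQ.1 ρ).quasiMeasurePreserving.ae
      (restrictFamily_ae_eq hQ.1.2.1 _)
  refine IndepFun.process_indepFun_process (fun a => by fun_prop) (fun a => by fun_prop)
    fun I J => ?_
  have hdisj : Disjoint ((I.sup id).map ρ) ((J.sup id).map σ) := by
    rw [Finset.disjoint_left]
    intro k hk hk'
    obtain ⟨i, -, rfl⟩ := Finset.mem_map.1 hk
    obtain ⟨j, -, hj⟩ := Finset.mem_map.1 hk'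
    exact h i j hj.symm
  have hind := (indepFun_iff_map_prod_eq_prod_map_map (measurable_pi_apply _).aemeasurable
    (measurable_pi_apply _).aemeasurable).2 (hQ.2 _ _ hdisj)
  exact (hind.comp ((D.measurable_restrictFamily (hsup _)).comp (D.map_measurable _))
    ((D.measurable_restrictFamily (hsup _)).comp (D.map_measurable _))).congr (hae ρ I) (hae σ J)

end BDS

section ConditionalIndependence

variable {Ω : Type*} {m₁ m₂ m₀ : MeasurableSpace Ω} {μ : Measure Ω} [IsProbabilityMeasure μ]

lemma integral_sq_condExp_sub_condExp (h₁₂ : m₁ ≤ m₂) (h₂ : m₂ ≤ m₀) {f : Ω → ℝ}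
    (hf : MemLp f 2 μ) :
    ∫ ω, ((μ[f|m₂]) ω - (μ[f|m₁]) ω) ^ 2 ∂μ
      = ∫ ω, (μ[f|m₂]) ω ^ 2 ∂μ - ∫ ω, (μ[f|m₁]) ω ^ 2 ∂μ := by
  have hX : MemLp (μ[f|m₂]) 2 μ := hf.condExp one_le_two
  have htower : μ[μ[f|m₂]|m₁] =ᵐ[μ] μ[f|m₁] := condExp_condExp_of_le h₁₂ h₂
  have hint : Integrable ((μ[f|m₂] - μ[μ[f|m₂]|m₁]) ^ 2) μ :=
    (hX.sub (hX.condExp one_le_two)).integrable_sq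
  calc ∫ ω, ((μ[f|m₂]) ω - (μ[f|m₁]) ω) ^ 2 ∂μ
      = ∫ ω, ((μ[f|m₂]) ω - (μ[μ[f|m₂]|m₁]) ω) ^ 2 ∂μ := by
        refine integral_congr_ae ?_
        filter_upwards [htower] with ω hω
        rw [hω]
    _ = ∫ ω, (Var[μ[f|m₂]; μ | m₁]) ω ∂μ := by
        have := setIntegral_condVar (hm := h₁₂.trans h₂) hint (MeasurableSet.univ (m := m₁))
        simpa using this.symm
    _ = ∫ ω, (μ[μ[f|m₂] ^ 2|m₁] - μ[μ[f|m₂]|m₁] ^ 2 : Ω → ℝ) ω ∂μ :=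
        integral_congr_ae (condVar_ae_eq_condExp_sq_sub_sq_condExp (h₁₂.trans h₂) hX)
    _ = ∫ ω, (μ[f|m₂]) ω ^ 2 ∂μ - ∫ ω, (μ[μ[f|m₂]|m₁]) ω ^ 2 ∂μ := by
        refine (integral_sub integrable_condExp (hX.condExp one_le_two).integrable_sq).trans ?_
        rw [integral_condExp (h₁₂.trans h₂)]
        rfl
    _ = _ := by
        congr 1
        refine integral_congr_ae ?_
        filter_upwards [htower] with ω hω
        rw [hω]

lemma integral_condExp_sq_mono (h₁₂ : m₁ ≤ m₂) (h₂ : m₂ ≤ m₀) {f : Ω → ℝ} (hf : MemLp f 2 μ) :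
    ∫ ω, (μ[f|m₁]) ω ^ 2 ∂μ ≤ ∫ ω, (μ[f|m₂]) ω ^ 2 ∂μ := by
  rw [← sub_nonneg, ← integral_sq_condExp_sub_condExp h₁₂ h₂ hf]
  exact integral_nonneg fun ω => sq_nonneg _

lemma condExp_ae_eq_of_integral_sq_le (h₁₂ : m₁ ≤ m₂) (h₂ : m₂ ≤ m₀) {f : Ω → ℝ}
    (hf : MemLp f 2 μ) (h : ∫ ω, (μ[f|m₂]) ω ^ 2 ∂μ ≤ ∫ ω, (μ[f|m₁]) ω ^ 2 ∂μ) :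
    μ[f|m₂] =ᵐ[μ] μ[f|m₁] := by
  have hint : Integrable (fun ω => ((μ[f|m₂]) ω - (μ[f|m₁]) ω) ^ 2) μ :=
    ((hf.condExp one_le_two).sub (hf.condExp one_le_two)).integrable_sq
  have h0 : ∫ ω, ((μ[f|m₂]) ω - (μ[f|m₁]) ω) ^ 2 ∂μ = 0 :=
    le_antisymm (by rw [integral_sq_condExp_sub_condExp h₁₂ h₂ hf]; linarith)
      (integral_nonneg fun ω => sq_nonneg _)
  filter_upwards [(integral_eq_zero_iff_of_nonneg (fun ω => sq_nonneg _) hint).1 h0] with ω hω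
  exact sub_eq_zero.1 (pow_eq_zero_iff two_ne_zero |>.1 hω)

variable {E F G : Type*} [mE : MeasurableSpace E] [mF : MeasurableSpace F] [MeasurableSpace G]
  [StandardBorelSpace G] [Nonempty G]

lemma integral_condExp_sq_eq_of_map_eq {Z : Ω → G} {V W : Ω → F} (hZ : Measurable Z)
    (hV : Measurable V) (hW : Measurable W)
    (h : μ.map (fun ω => (V ω, Z ω)) = μ.map fun ω => (W ω, Z ω))
    {B : Set G} (hB : MeasurableSet B) :
    ∫ ω, (μ⟦Z ⁻¹' B|mF.comap V⟧) ω ^ 2 ∂μ = ∫ ω, (μ⟦Z ⁻¹' B|mF.comap W⟧) ω ^ 2 ∂μ := by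
  have key : ∀ U : Ω → F, Measurable U → ∫ ω, (μ⟦Z ⁻¹' B|mF.comap U⟧) ω ^ 2 ∂μ
      = ∫ u, (condDistrib Z U μ u).real B ^ 2 ∂(μ.map U) := by
    intro U hU
    rw [integral_map hU.aemeasurable]
    · refine integral_congr_ae ?_
      filter_upwards [condDistrib_ae_eq_condExp hU hZ hB] with ω hω
      rw [← hω]
    · exact ((Kernel.measurable_coe _ hB).ennreal_toReal.pow_const 2).aestronglyMeasurable
  have hmap : μ.map V = μ.map W := by
    have := congrArg Measure.fst h
    rwa [Measure.fst_map_prodMk hZ, Measure.fst_map_prodMk hZ] at this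
  rw [key V hV, key W hW, hmap]
  simp only [condDistrib, h]

/-- If `Y` is a function of `W`, and replacing `W` by some function of `Y` does not change the
joint law with `Z`, then conditioning `Z` on `W` or on `Y` is the same. -/
lemma condExp_comap_ae_eq_of_map_eq {Z : Ω → G} {Y : Ω → E} {W : Ω → F} (hZ : Measurable Z)
    (hY : Measurable Y) (hW : Measurable W) {p : F → E} (hp : Measurable p) (hpW : Y = p ∘ W)
    {q : E → F} (hq : Measurable q)
    (h : μ.map (fun ω => (W ω, Z ω)) = μ.map fun ω => (q (Y ω), Z ω))
    {B : Set G} (hB : MeasurableSet B) :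
    μ⟦Z ⁻¹' B|mF.comap W⟧ =ᵐ[μ] μ⟦Z ⁻¹' B|mE.comap Y⟧ := by
  have hf : MemLp ((Z ⁻¹' B).indicator fun _ => (1 : ℝ)) 2 μ :=
    memLp_indicator_const _ (hZ hB) _ (Or.inr (measure_ne_top _ _))
  refine condExp_ae_eq_of_integral_sq_le ?_ hW.comap_le hf ?_
  · rw [hpW, ← MeasurableSpace.comap_comp]
    exact MeasurableSpace.comap_mono hp.comap_le
  · rw [integral_condExp_sq_eq_of_map_eq hZ hW (hq.comp hY) h hB]
    refine integral_condExp_sq_mono ?_ hY.comap_le hf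
    rw [← MeasurableSpace.comap_comp]
    exact MeasurableSpace.comap_mono hq.comap_le

/-- If the joint law of `(Y, X, Z)` is that of `(q Y, r Y, Z)`, then `X` and `Z` are conditionally
independent given `Y`. -/
lemma condIndepFun_of_map_eq [StandardBorelSpace Ω] {X : Ω → F} {Z : Ω → G} {Y : Ω → E}
    (hX : Measurable X) (hZ : Measurable Z) (hY : Measurable Y)
    {q : E → E × F} (hq : Measurable q)
    (h : μ.map (fun ω => ((Y ω, X ω), Z ω)) = μ.map fun ω => (q (Y ω), Z ω)) :
    X ⟂ᵢ[Y, hY; μ] Z := by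
  rw [condIndepFun_iff_condExp_inter_preimage_eq_mul hX hZ]
  intro A B hA hB
  have hW : Measurable fun ω => (Y ω, X ω) := hY.prodMk hX
  have hle : mE.comap Y ≤ (mE.prod mF).comap fun ω => (Y ω, X ω) := by
    rw [show Y = Prod.fst ∘ fun ω => (Y ω, X ω) from rfl, ← MeasurableSpace.comap_comp]
    exact MeasurableSpace.comap_mono measurable_fst.comap_le
  set f : Ω → ℝ := (X ⁻¹' A).indicator fun _ => (1 : ℝ) with hf
  set g : Ω → ℝ := (Z ⁻¹' B).indicator fun _ => (1 : ℝ) with hg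
  have hfg : ((X ⁻¹' A ∩ Z ⁻¹' B).indicator fun _ => (1 : ℝ)) = f * g := by
    ext ω
    simp [hf, hg, ← Set.inter_indicator_mul]
  have hfm : StronglyMeasurable[(mE.prod mF).comap fun ω => (Y ω, X ω)] f := by
    refine StronglyMeasurable.indicator stronglyMeasurable_const ?_
    exact ⟨Set.univ ×ˢ A, MeasurableSet.univ.prod hA, by ext; simp⟩
  have hgi : Integrable g μ := (integrable_const _).indicator (hZ hB)
  have hfi : Integrable f μ := (integrable_const _).indicator (hX hA)
  have hfb : ∀ ω, ‖f ω‖ ≤ 1 := fun ω => by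
    rw [hf]; exact (norm_indicator_le_norm_self _ _).trans (by simp)
  have hfa : AEStronglyMeasurable f μ := hfi.aestronglyMeasurable
  have e₁ : μ[f * g|(mE.prod mF).comap fun ω => (Y ω, X ω)] =ᵐ[μ] f * μ[g|mE.comap Y] :=
    (condExp_mul_of_stronglyMeasurable_left hfm (hgi.bdd_mul hfa (.of_forall hfb)) hgi).trans
      ((Filter.EventuallyEq.refl _ f).mul
        (condExp_comap_ae_eq_of_map_eq hZ hY hW measurable_fst rfl hq h hB))
  rw [hfg]
  calc μ[f * g|mE.comap Y]
      =ᵐ[μ] μ[μ[f * g|(mE.prod mF).comap fun ω => (Y ω, X ω)]|mE.comap Y] :=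
        (condExp_condExp_of_le hle hW.comap_le).symm
    _ =ᵐ[μ] μ[f * μ[g|mE.comap Y]|mE.comap Y] := condExp_congr_ae e₁
    _ =ᵐ[μ] μ[f|mE.comap Y] * μ[g|mE.comap Y] :=
        condExp_mul_of_stronglyMeasurable_right stronglyMeasurable_condExp
          (integrable_condExp.bdd_mul hfa (.of_forall hfb)) hfi

end ConditionalIndependence

section MeasurabilityOfLaws

/-- Two finite kernels into a countably generated space agree on a measurable set. -/
lemma measurableSet_kernel_eq {T E : Type*} [MeasurableSpace T] [mE : MeasurableSpace E]
    [MeasurableSpace.CountablyGenerated E] (κ η : Kernel T E) [IsFiniteKernel κ] :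
    MeasurableSet {t | κ t = η t} := by
  set C := generateSetAlgebra (MeasurableSpace.countableGeneratingSet E) with hCdef
  have halg : IsSetAlgebra C := isSetAlgebra_generateSetAlgebra
  have hgen : mE = MeasurableSpace.generateFrom C := by
    rw [hCdef, generateFrom_generateSetAlgebra_eq,
      MeasurableSpace.generateFrom_countableGeneratingSet]
  have hcount : C.Countable :=
    countable_generateSetAlgebra (MeasurableSpace.countable_countableGeneratingSet)
  have hmeas : ∀ s ∈ C, MeasurableSet s := fun s hs => by
    rw [hgen]; exact MeasurableSpace.measurableSet_generateFrom hs
  have : {t | κ t = η t} = ⋂ s ∈ C, {t | κ t s = η t s} := by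
    ext t
    simp only [Set.mem_ofPred_eq, Set.mem_iInter]
    refine ⟨fun h s _ => by rw [h], fun h => ?_⟩
    exact ext_of_generate_finite C hgen (fun s hs t ht _ => halg.inter_mem hs ht) h
      (h _ halg.univ_mem)
  rw [this]
  exact MeasurableSet.biInter hcount fun s hs =>
    measurableSet_eq_fun (κ.measurable_coe (hmeas s hs)) (η.measurable_coe (hmeas s hs))

variable (D : BDS)

lemma measurableSet_isProbabilityMeasure (E : Type*) [MeasurableSpace E] :
    MeasurableSet {Q : Measure E | IsProbabilityMeasure Q} := by
  simp only [isProbabilityMeasure_iff]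
  exact Measure.measurable_coe MeasurableSet.univ (measurableSet_singleton 1)

lemma measurableSet_consistency (b a : Finset ℕ) (h : b ⊆ a) :
    MeasurableSet {x : ∀ a : Finset ℕ, D.obj a | D.map (inclEmb h) (x a) = x b} :=
  measurableSet_eq_fun (by fun_prop) (by fun_prop)

lemma measurableSet_eSYMset : MeasurableSet (eSYMset D) := by
  set P := {Q : Measure (∀ a : Finset ℕ, D.obj a) | IsProbabilityMeasure Q} with hP
  have hPm : MeasurableSet P := measurableSet_isProbabilityMeasure _
  let κ : Kernel P (∀ a : Finset ℕ, D.obj a) := ⟨Subtype.val, measurable_subtype_coe⟩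
  have hκ : ∀ Q, κ Q = Q := fun Q => rfl
  have : IsMarkovKernel κ := ⟨fun Q => Q.2⟩
  have hset : eSYMset D = Subtype.val '' {Q : P |
      (∀ (b a : Finset ℕ) (h : b ⊆ a),
        (Q : Measure (∀ a : Finset ℕ, D.obj a)) {x | D.map (inclEmb h) (x a) = x b}ᶜ = 0) ∧
      (∀ (a : Finset ℕ) (π : ↥a ≃ ↥a),
        κ.map (fun x => D.map π.toEmbedding (x a)) Q = κ.map (fun x => x a) Q) ∧
      ∀ a b : Finset ℕ, Disjoint a b →
        κ.map (fun x => (x a, x b)) Q = ((κ.map fun x => x a) ×ₖ (κ.map fun x => x b)) Q} := by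
    ext Q
    constructor
    · rintro ⟨⟨hp, hc, he⟩, hi⟩
      refine ⟨⟨Q, hp⟩, ⟨hc, fun a π => ?_, fun a b hab => ?_⟩, rfl⟩
      · rw [Kernel.map_apply _ (by fun_prop), Kernel.map_apply _ (by fun_prop)]
        exact he a π
      · rw [Kernel.prod_apply, Kernel.map_apply _ (by fun_prop), Kernel.map_apply _ (by fun_prop),
          Kernel.map_apply _ (by fun_prop)]
        exact hi a b hab
    · rintro ⟨⟨Q, hp⟩, ⟨hc, he, hi⟩, rfl⟩
      refine ⟨⟨hp, hc, fun a π => ?_⟩, fun a b hab => ?_⟩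
      · have := he a π
        rwa [Kernel.map_apply _ (by fun_prop), Kernel.map_apply _ (by fun_prop)] at this
      · have := hi a b hab
        rwa [Kernel.prod_apply, Kernel.map_apply _ (by fun_prop), Kernel.map_apply _ (by fun_prop),
          Kernel.map_apply _ (by fun_prop)] at this
  rw [hset]
  refine hPm.subtype_image (measurableSet_setOfPred.2 (.and ?_ (.and ?_ ?_)))
  · refine .forall fun b => .forall fun a => .forall fun h => measurableSet_setOfPred.1 ?_
    exact κ.measurable_coe (measurableSet_consistency D b a h).compl (measurableSet_singleton 0)
  · exact .forall fun a => .forall fun π => measurableSet_setOfPred.1 (measurableSet_kernel_eq _ _)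
  · exact .forall fun a => .forall fun b => .forall fun _ =>
      measurableSet_setOfPred.1 (measurableSet_kernel_eq _ _)

end MeasurabilityOfLaws

namespace BDS

/-- The embedding of `ℕ` onto the even numbers. -/
def evenEmb : ℕ ↪ ℕ := ⟨fun n => 2 * n, fun i j h => by simpa using h⟩

/-- The embedding of `ℕ` onto the odd numbers. -/
def oddEmb : ℕ ↪ ℕ := ⟨fun n => 2 * n + 1, fun i j h => by simpa using h⟩

lemma evenEmb_apply (n : ℕ) : evenEmb n = 2 * n := rfl

lemma oddEmb_apply (n : ℕ) : oddEmb n = 2 * n + 1 := rfl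

lemma exists_trans_evenEmb_oddEmb {α β : ℕ ↪ ℕ} (h : ∀ i j, α i ≠ β j) :
    ∃ γ : ℕ ↪ ℕ, evenEmb.trans γ = α ∧ oddEmb.trans γ = β := by
  refine ⟨⟨fun n => if n % 2 = 0 then α (n / 2) else β (n / 2), fun i j hij => ?_⟩, ?_, ?_⟩
  · dsimp only at hij
    split_ifs at hij with hi hj hj
    · have := α.injective hij
      omega
    · exact absurd hij (h _ _)
    · exact absurd hij.symm (h _ _)
    · have := β.injective hij
      omega
  · ext n
    change (if 2 * n % 2 = 0 then α (2 * n / 2) else β (2 * n / 2)) = α n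
    simp
  · ext n
    change (if (2 * n + 1) % 2 = 0 then α ((2 * n + 1) / 2) else β ((2 * n + 1) / 2)) = β n
    rw [if_neg (by omega), show (2 * n + 1) / 2 = n by omega]

variable {D : BDS} {Q : Measure (∀ a : Finset ℕ, D.obj a)}

/-- The joint law of the measurements with odd IDs and those with even IDs does not change if
the IDs are replaced by those given by any two injections with disjoint ranges. -/
lemma map_reindex_odd_even {T : Type*} [MeasurableSpace T] (hQ : Q ∈ SYMset D) {α β : ℕ ↪ ℕ}
    (h : ∀ i j, α i ≠ β j)
    {F : (∀ a : Finset ℕ, D.obj a) → (∀ a : Finset ℕ, D.obj a) → T}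
    (hF : Measurable fun p : (∀ a : Finset ℕ, D.obj a) × (∀ a : Finset ℕ, D.obj a) =>
      F p.1 p.2) :
    Q.map (fun x => F (D.reindex oddEmb x) (D.reindex evenEmb x))
      = Q.map fun x => F (D.reindex β x) (D.reindex α x) := by
  obtain ⟨γ, rfl, rfl⟩ := exists_trans_evenEmb_oddEmb h
  have hm : Measurable fun x => F (D.reindex oddEmb x) (D.reindex evenEmb x) :=
    hF.comp ((D.measurable_reindex oddEmb).prodMk (D.measurable_reindex evenEmb))
  conv_lhs => rw [← (measurePreserving_reindex hQ γ).map_eq,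
    Measure.map_map hm (D.measurable_reindex γ)]
  simp only [Function.comp_def, reindex_reindex]

lemma condDistrib_eq_of_map_eq {Ω E G : Type*} [MeasurableSpace Ω] [MeasurableSpace E]
    [MeasurableSpace G] [StandardBorelSpace G] [Nonempty G] {μ : Measure Ω} [IsFiniteMeasure μ]
    {X X' : Ω → G} {Y : Ω → E}
    (h : μ.map (fun ω => (Y ω, X ω)) = μ.map fun ω => (Y ω, X' ω)) :
    condDistrib X Y μ = condDistrib X' Y μ := by
  simp only [condDistrib, h]

section Directing

variable [Nonempty (∀ a : Finset ℕ, D.obj a)]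

/-- The conditional law of the measurements with even IDs given those with odd IDs. -/
noncomputable def directingKernel (D : BDS) [Nonempty (∀ a : Finset ℕ, D.obj a)]
    (Q : Measure (∀ a : Finset ℕ, D.obj a)) [IsFiniteMeasure Q] :
    Kernel (∀ a : Finset ℕ, D.obj a) (∀ a : Finset ℕ, D.obj a) :=
  condDistrib (D.reindex evenEmb) (D.reindex oddEmb) Q

instance [IsFiniteMeasure Q] : IsMarkovKernel (D.directingKernel Q) := by
  unfold directingKernel
  infer_instance

lemma directingKernel_comp (hQ : Q ∈ SYMset D) [IsProbabilityMeasure Q] :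
    D.directingKernel Q ∘ₘ Q.map (D.reindex oddEmb) = Q := by
  rw [directingKernel, condDistrib_comp_map (by fun_prop) (by fun_prop)]
  exact (measurePreserving_reindex hQ _).map_eq

lemma directingKernel_map [IsFiniteMeasure Q] {G : Type*} [MeasurableSpace G]
    [StandardBorelSpace G] [Nonempty G] {f : (∀ a : Finset ℕ, D.obj a) → G} (hf : Measurable f) :
    ∀ᵐ y ∂Q.map (D.reindex oddEmb), (D.directingKernel Q y).map f
      = condDistrib (fun x => f (D.reindex evenEmb x)) (D.reindex oddEmb) Q y := by
  filter_upwards [condDistrib_comp (μ := Q) (D.reindex oddEmb)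
    (D.measurable_reindex evenEmb).aemeasurable hf] with y hy
  rw [Function.comp_def, Kernel.map_apply _ hf] at hy
  exact hy.symm

lemma evenEmb_ne_oddEmb (i j : ℕ) : evenEmb i ≠ oddEmb j := by
  simp only [evenEmb_apply, oddEmb_apply]
  omega

lemma ae_jointConsistent_directingKernel (hQ : Q ∈ SYMset D) [IsProbabilityMeasure Q] :
    ∀ᵐ y ∂Q.map (D.reindex oddEmb), jointConsistent D (D.directingKernel Q y) := by
  refine ae_all_iff.2 fun b => ae_all_iff.2 fun a => ae_all_iff.2 fun h => ?_
  refine Measure.ae_ae_of_ae_comp ?_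
  rw [directingKernel_comp hQ]
  exact hQ.2.1 b a h

lemma ae_jointExchangeable_directingKernel (hQ : Q ∈ SYMset D) [IsProbabilityMeasure Q] :
    ∀ᵐ y ∂Q.map (D.reindex oddEmb), jointExchangeable D (D.directingKernel Q y) := by
  refine ae_all_iff.2 fun a => ae_all_iff.2 fun π => ?_
  have : Nonempty (D.obj a) := ‹Nonempty (∀ a, D.obj a)›.map fun x => x a
  have hm := D.map_measurable π.toEmbedding
  set π' : Equiv.Perm ℕ := Equiv.Perm.ofSubtype π with hπ'
  have hπ : ∀ i : ↥a, (π i : ℕ) = π' i := fun i => (Equiv.Perm.ofSubtype_apply_coe π i).symm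
  have hmap : a.map π'.toEmbedding = a := by
    refine Finset.eq_of_subset_of_card_le (fun j hj => ?_) (by simp)
    obtain ⟨i, hi, rfl⟩ := Finset.mem_map.1 hj
    exact hπ ⟨i, hi⟩ ▸ (π ⟨i, hi⟩).2
  have hlaw : Q.map (fun x => (D.reindex oddEmb x, D.map π.toEmbedding (D.reindex evenEmb x a)))
      = Q.map fun x => (D.reindex oddEmb x, D.reindex evenEmb x a) := by
    rw [map_reindex_odd_even hQ (F := fun y x => (y, x a)) (α := π'.toEmbedding.trans evenEmb)
      (β := oddEmb) (fun i j => evenEmb_ne_oddEmb _ _) (by fun_prop)]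
    simp only [← reindex_reindex]
    simp only [D.reindex_eq_map hmap π.toEmbedding hπ]
  filter_upwards [directingKernel_map (Q := Q) (f := fun x => D.map π.toEmbedding (x a))
    (by fun_prop), directingKernel_map (Q := Q) (f := fun x => x a) (by fun_prop)] with y h₁ h₂
  rw [h₁, h₂, condDistrib_eq_of_map_eq hlaw]

lemma condIndepFun_reindex_evenEmb (hQ : Q ∈ SYMset D) [IsProbabilityMeasure Q]
    {a b : Finset ℕ} (hab : Disjoint a b) :
    (fun x => D.reindex evenEmb x a) ⟂ᵢ[D.reindex oddEmb, D.measurable_reindex oddEmb; Q]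
      (fun x => D.reindex evenEmb x b) := by
  have : Nonempty (D.obj b) := ‹Nonempty (∀ a, D.obj a)›.map fun x => x b
  let shift : ℕ ↪ ℕ := addRightEmbedding (a.sup id + 1)
  let α : ℕ ↪ ℕ := ⟨fun i => if i ∈ a then oddEmb i else evenEmb i, fun i j hij => by
    dsimp only at hij
    simp only [oddEmb_apply, evenEmb_apply] at hij
    split_ifs at hij <;> omega⟩
  have hαa : ∀ i ∈ a, α i = oddEmb i := fun i hi => if_pos hi
  have hαb : ∀ i ∈ b, α i = evenEmb i := fun i hi => if_neg (Finset.disjoint_right.1 hab hi)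
  have hα : ∀ i j, α i ≠ (shift.trans oddEmb) j := by
    intro i j
    change (if i ∈ a then 2 * i + 1 else 2 * i) ≠ 2 * (j + (a.sup id + 1)) + 1
    split_ifs with hi
    · have : i ≤ a.sup id := Finset.le_sup (f := id) hi
      omega
    · omega
  refine condIndepFun_of_map_eq (by fun_prop) (by fun_prop)
    (D.measurable_reindex oddEmb) (q := fun y => (D.reindex shift y, y a)) (by fun_prop) ?_
  rw [map_reindex_odd_even hQ (F := fun y x => ((y, x a), x b)) hα (by fun_prop)]
  simp only [← reindex_reindex, D.reindex_congr hαa, D.reindex_congr hαb]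

lemma ae_indepProperty_directingKernel (hQ : Q ∈ SYMset D) [IsProbabilityMeasure Q] :
    ∀ᵐ y ∂Q.map (D.reindex oddEmb), indepProperty D (D.directingKernel Q y) := by
  refine ae_all_iff.2 fun a => ae_all_iff.2 fun b => ae_all_iff.2 fun hab => ?_
  have : Nonempty (D.obj a) := ‹Nonempty (∀ a, D.obj a)›.map fun x => x a
  have : Nonempty (D.obj b) := ‹Nonempty (∀ a, D.obj a)›.map fun x => x b
  have h := (condIndepFun_iff_map_prod_eq_prod_condDistrib_prod_condDistrib (by fun_prop)
    (by fun_prop) (D.measurable_reindex oddEmb)).1 (condIndepFun_reindex_evenEmb hQ hab)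
  rw [← Measure.compProd_eq_comp_prod] at h
  filter_upwards [condDistrib_ae_eq_of_measure_eq_compProd _ (by fun_prop) h,
    directingKernel_map (Q := Q) (f := fun x => (x a, x b)) (by fun_prop),
    directingKernel_map (Q := Q) (f := fun x => x a) (by fun_prop),
    directingKernel_map (Q := Q) (f := fun x => x b) (by fun_prop)] with y hy h₁ h₂ h₃
  rw [h₁, h₂, h₃, hy, Kernel.prod_apply]

lemma ae_directingKernel_mem_eSYMset (hQ : Q ∈ SYMset D) [IsProbabilityMeasure Q] :
    ∀ᵐ y ∂Q.map (D.reindex oddEmb), D.directingKernel Q y ∈ eSYMset D := by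
  filter_upwards [ae_jointConsistent_directingKernel hQ, ae_jointExchangeable_directingKernel hQ,
    ae_indepProperty_directingKernel hQ] with y hc he hi
  exact ⟨⟨inferInstance, hc, he⟩, hi⟩

end Directing

lemma exists_join_eq (hQ : Q ∈ SYMset D) : ∃ Ξ : Measure (Measure (∀ a : Finset ℕ, D.obj a)),
    IsProbabilityMeasure Ξ ∧ Ξ (eSYMset D) = 1 ∧ Ξ.join = Q := by
  have hp : IsProbabilityMeasure Q := hQ.1
  have : Nonempty (∀ a : Finset ℕ, D.obj a) := Q.nonempty_of_neZero
  have hκ := (D.directingKernel Q).measurable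
  have hY : IsProbabilityMeasure (Q.map (D.reindex oddEmb)) :=
    Measure.isProbabilityMeasure_map (by fun_prop)
  have hΞ : IsProbabilityMeasure ((Q.map (D.reindex oddEmb)).map (D.directingKernel Q)) :=
    Measure.isProbabilityMeasure_map hκ.aemeasurable
  refine ⟨_, hΞ, ?_, directingKernel_comp hQ⟩
  rw [← mem_ae_iff_prob_eq_one (measurableSet_eSYMset D)]
  exact (ae_map_iff hκ.aemeasurable (measurableSet_eSYMset D)).2
    (ae_directingKernel_mem_eSYMset hQ)

end BDS

namespace BDS

open Filter Topology ENNReal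

variable {D : BDS}

/-- The injections `n ↦ Nat.pair k n`, whose ranges are disjoint for distinct `k`. -/
def pairEmb (k : ℕ) : ℕ ↪ ℕ := ⟨fun n => Nat.pair k n, fun _ _ h => (Nat.pair_eq_pair.1 h).2⟩

lemma pairEmb_ne {k l : ℕ} (h : k ≠ l) (i j : ℕ) : pairEmb k i ≠ pairEmb l j := fun hij =>
  h (Nat.pair_eq_pair.1 hij).1

/-- The asymptotic frequency with which the reindexings along `pairEmb k` of a family of
measurements belong to `B`. -/
noncomputable def frequency (D : BDS) (B : Set (∀ a : Finset ℕ, D.obj a))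
    (x : ∀ a : Finset ℕ, D.obj a) : ℝ≥0∞ :=
  limsup (fun n : ℕ => ENNReal.ofReal
    ((∑ k ∈ Finset.range n, B.indicator (fun _ => (1 : ℝ)) (D.reindex (pairEmb k) x)) / n)) atTop

lemma measurable_frequency {B : Set (∀ a : Finset ℕ, D.obj a)} (hB : MeasurableSet B) :
    Measurable (D.frequency B) := by
  have : Measurable (B.indicator fun _ => (1 : ℝ)) := measurable_const.indicator hB
  unfold frequency
  refine Measurable.limsup fun n => ENNReal.measurable_ofReal.comp (Measurable.div_const ?_ _)
  exact Finset.measurable_sum _ fun k _ => this.comp (D.measurable_reindex _)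

lemma frequency_ae_eq {μ : Measure (∀ a : Finset ℕ, D.obj a)} (hμ : μ ∈ eSYMset D)
    {B : Set (∀ a : Finset ℕ, D.obj a)} (hB : MeasurableSet B) :
    ∀ᵐ x ∂μ, D.frequency B x = μ B := by
  have hp : IsProbabilityMeasure μ := hμ.1.1
  have hf : Measurable (B.indicator fun _ => (1 : ℝ)) := measurable_const.indicator hB
  have hfi : Integrable (B.indicator fun _ => (1 : ℝ)) μ := (integrable_const _).indicator hB
  have hpres := fun k => measurePreserving_reindex hμ.1 (pairEmb k)
  have hlim := strong_law_ae_real (μ := μ)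
    (fun k x => B.indicator (fun _ => (1 : ℝ)) (D.reindex (pairEmb k) x))
    ((hpres 0).integrable_comp_of_integrable hfi)
    (fun k l hkl => (indepFun_reindex hμ (pairEmb_ne hkl)).comp hf hf)
    (fun k => ⟨(hf.comp (D.measurable_reindex _)).aemeasurable,
      (hf.comp (D.measurable_reindex _)).aemeasurable, by
        change μ.map (B.indicator (fun _ => (1 : ℝ)) ∘ D.reindex _)
          = μ.map (B.indicator (fun _ => (1 : ℝ)) ∘ D.reindex _)
        rw [← Measure.map_map hf (by fun_prop), ← Measure.map_map hf (by fun_prop),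
          (hpres k).map_eq, (hpres 0).map_eq]⟩)
  have hint : ∫ x, B.indicator (fun _ => (1 : ℝ)) (D.reindex (pairEmb 0) x) ∂μ = μ.real B := by
    rw [← integral_map (D.measurable_reindex _).aemeasurable hf.aestronglyMeasurable,
      (hpres 0).map_eq, integral_indicator_const _ hB, smul_eq_mul, mul_one]
  filter_upwards [hlim] with x hx
  rw [hint] at hx
  have := (ENNReal.continuous_ofReal.tendsto _).comp hx
  rw [ofReal_measureReal] at this
  exact this.limsup_eq

lemma map_eval_eq_map_join {Ξ : Measure (Measure (∀ a : Finset ℕ, D.obj a))}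
    (hΞ : ∀ᵐ μ ∂Ξ, μ ∈ eSYMset D)
    (J : Finset {B : Set (∀ a : Finset ℕ, D.obj a) // MeasurableSet B}) :
    Ξ.map (fun μ (j : J) => μ j.1.1) = Ξ.join.map fun x (j : J) => D.frequency j.1.1 x := by
  have hE : Measurable fun (μ : Measure (∀ a : Finset ℕ, D.obj a)) (j : J) => μ j.1.1 :=
    measurable_pi_lambda _ fun j => Measure.measurable_coe j.1.2
  have hF : Measurable fun x (j : J) => D.frequency j.1.1 x :=
    measurable_pi_lambda _ fun j => measurable_frequency j.1.2
  ext s hs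
  rw [Measure.map_apply hE hs, Measure.map_apply hF hs, Measure.join_apply (hF hs),
    ← lintegral_indicator_one (hE hs)]
  refine lintegral_congr_ae ?_
  filter_upwards [hΞ] with μ hμ
  have hp : IsProbabilityMeasure μ := hμ.1.1
  have hae : ∀ᵐ x ∂μ, (fun j : J => D.frequency j.1.1 x) = fun j : J => μ j.1.1 := by
    filter_upwards [ae_all_iff.2 fun j : J => frequency_ae_eq hμ j.1.2] with x hx
    exact funext hx
  have : μ ((fun x (j : J) => D.frequency j.1.1 x) ⁻¹' s)
      = μ {x | (fun j : J => μ j.1.1) ∈ s} := by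
    refine measure_congr ?_
    filter_upwards [hae] with x hx
    exact congrArg (· ∈ s) hx
  rw [this]
  by_cases hmem : (fun j : J => μ j.1.1) ∈ s
  · simp [hmem]
  · simp [hmem]

/-- The law of a random measure is determined by the joint laws of its values on finitely many
measurable sets. -/
lemma _root_.measure_ext_of_map_eval {E : Type*} [MeasurableSpace E]
    {Ξ₁ Ξ₂ : Measure (Measure E)} [IsFiniteMeasure Ξ₁]
    (h : ∀ J : Finset {B : Set E // MeasurableSet B},
      Ξ₁.map (fun μ (j : J) => μ j.1.1) = Ξ₂.map fun μ (j : J) => μ j.1.1) : Ξ₁ = Ξ₂ := by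
  have hE : Measurable fun (μ : Measure E) (B : {B : Set E // MeasurableSet B}) => μ B.1 :=
    measurable_pi_lambda _ fun B => Measure.measurable_coe B.2
  have hmap : Ξ₁.map (fun (μ : Measure E) (B : {B : Set E // MeasurableSet B}) => μ B.1)
      = Ξ₂.map (fun (μ : Measure E) (B : {B : Set E // MeasurableSet B}) => μ B.1) := by
    refine IsProjectiveLimit.unique
      (P := fun J : Finset {B : Set E // MeasurableSet B} => Ξ₁.map fun μ (j : J) => μ j.1.1)
      (fun J => ?_) fun J => ?_
    · rw [Measure.map_map (Finset.measurable_restrict J) hE]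
      rfl
    · rw [Measure.map_map (Finset.measurable_restrict J) hE]
      exact (h J).symm
  have hle : (Measure.instMeasurableSpace : MeasurableSpace (Measure E))
      ≤ MeasurableSpace.pi.comap
        fun (μ : Measure E) (B : {B : Set E // MeasurableSet B}) => μ B.1 := by
    refine iSup₂_le fun s hs => ?_
    rintro _ ⟨t, ht, rfl⟩
    exact ⟨(fun f => f ⟨s, hs⟩) ⁻¹' t, measurable_pi_apply _ ht, rfl⟩
  ext s hs
  obtain ⟨t, ht, rfl⟩ := hle s hs
  rw [← Measure.map_apply hE ht, hmap, Measure.map_apply hE ht]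

lemma join_mem_SYMset {Ξ : Measure (Measure (∀ a : Finset ℕ, D.obj a))} [IsProbabilityMeasure Ξ]
    (hΞ : ∀ᵐ μ ∂Ξ, μ ∈ SYMset D) : Ξ.join ∈ SYMset D := by
  refine ⟨⟨?_⟩, fun b a h => ?_, fun a π => ?_⟩
  · rw [Measure.join_apply .univ, lintegral_congr_ae (g := fun _ => 1), lintegral_one,
      measure_univ]
    filter_upwards [hΞ] with μ hμ
    have := hμ.1
    exact measure_univ
  · change Ξ.join {x | D.map (inclEmb h) (x a) = x b}ᶜ = 0
    rw [Measure.join_apply (measurableSet_consistency D b a h).compl,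
      lintegral_congr_ae (g := fun _ => 0), lintegral_zero]
    filter_upwards [hΞ] with μ hμ
    exact hμ.2.1 b a h
  · ext s hs
    have hm := D.map_measurable π.toEmbedding
    have h₁ : Measurable fun x : ∀ a : Finset ℕ, D.obj a => D.map π.toEmbedding (x a) := by
      fun_prop
    rw [Measure.map_apply h₁ hs, Measure.map_apply (measurable_pi_apply a) hs,
      Measure.join_apply (h₁ hs), Measure.join_apply (measurable_pi_apply a hs)]
    refine lintegral_congr_ae ?_
    filter_upwards [hΞ] with μ hμ
    rw [← Measure.map_apply h₁ hs, hμ.2.2 a π, Measure.map_apply (measurable_pi_apply a) hs]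

end BDS

/-- Generalized de Finetti theorem: if `SYM(D) ≠ ∅` then `eSYM(D)` is a non-empty
measurable subset of `SYM(D)`, and mixing, i.e. `Ξ ↦ E[Ξ] = Ξ.join`, is a bijection
from the probability measures concentrated on `eSYM(D)` onto `SYM(D)`. -/
theorem generalized_deFinetti (D : BDS) (hne : (SYMset D).Nonempty) :
    (eSYMset D).Nonempty ∧
    MeasurableSet {q : ↥(SYMset D) | (q : Measure (∀ a : Finset ℕ, D.obj a)) ∈ eSYMset D} ∧
    Set.BijOn (fun Ξ : Measure (Measure (∀ a : Finset ℕ, D.obj a)) => Ξ.join)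
      {Ξ : Measure (Measure (∀ a : Finset ℕ, D.obj a)) |
        IsProbabilityMeasure Ξ ∧ Ξ (eSYMset D) = 1}
      (SYMset D) := by
  have hae : ∀ Ξ : Measure (Measure (∀ a : Finset ℕ, D.obj a)), IsProbabilityMeasure Ξ →
      Ξ (eSYMset D) = 1 → ∀ᵐ μ ∂Ξ, μ ∈ eSYMset D := fun Ξ _ h =>
    (mem_ae_iff_prob_eq_one (measurableSet_eSYMset D)).2 h
  refine ⟨?_, (measurableSet_eSYMset D).preimage measurable_subtype_coe, ?_, ?_, ?_⟩
  · obtain ⟨Q, hQ⟩ := hne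
    obtain ⟨Ξ, -, hΞ, -⟩ := BDS.exists_join_eq hQ
    refine Set.nonempty_iff_ne_empty.2 fun h => ?_
    rw [h, measure_empty] at hΞ
    exact zero_ne_one hΞ
  · rintro Ξ ⟨hp, hΞ⟩
    exact BDS.join_mem_SYMset ((hae Ξ hp hΞ).mono fun μ hμ => hμ.1)
  · rintro Ξ₁ ⟨hp₁, h₁⟩ Ξ₂ ⟨hp₂, h₂⟩ (h : Ξ₁.join = Ξ₂.join)
    refine measure_ext_of_map_eval fun J => ?_
    rw [BDS.map_eval_eq_map_join (hae Ξ₁ hp₁ h₁), BDS.map_eval_eq_map_join (hae Ξ₂ hp₂ h₂), h]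
  · intro Q hQ
    obtain ⟨Ξ, hp, hΞ, rfl⟩ := BDS.exists_join_eq hQ
    exact ⟨Ξ, ⟨hp, hΞ⟩, rfl⟩
end

section
/- Correspondence between limits of combinatorial structures and ergodic exchangeable laws: let D be a combinatorial data structure over ℕ (each D_a a non-empty finite discrete space) such that the underlying set a is recoverable from x ∈ D_a, and for x ∈ D_b, y ∈ D_a with |b| ≤ |a| define density(x,y) = ℙ[D[T](y) = x] for a uniformly random injection T : b → a. Call a sequence (x_n) with x_n ∈ D_{a_n} convergent if |a_n| → ∞ and lim_n density(x,x_n) exists for every x. Then: for every convergent sequence (x_n) there is exactly one exchangeable law μ on D with the independence property such that μ_b({x}) = lim_n density(x,x_n) for every finite b and x ∈ D_b; and conversely, every exchangeable law on D with the independence property arises in this way from some convergent sequence. -/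
open MeasureTheory

/-- A combinatorial data structure over `ℕ`: a non-empty finite discrete space
`obj a` for each finite `a ⊆ ℕ`, with contravariant functorial restriction maps
along injections of finite subsets of `ℕ`. -/
structure CDS where
  obj : Finset ℕ → Type
  fin : ∀ a : Finset ℕ, Fintype (obj a)
  deq : ∀ a : Finset ℕ, DecidableEq (obj a)
  nonempty : ∀ a : Finset ℕ, Nonempty (obj a)
  map : ∀ {b a : Finset ℕ}, (↥b ↪ ↥a) → obj a → obj b
  map_id : ∀ a : Finset ℕ, map (Function.Embedding.refl ↥a) = id
  map_comp : ∀ {c b a : Finset ℕ} (σ : ↥c ↪ ↥b) (τ : ↥b ↪ ↥a),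
    map (σ.trans τ) = map σ ∘ map τ

attribute [instance] CDS.fin CDS.deq

/-- An exchangeable law on a combinatorial data structure, given by its
probability weights, compatible with all restriction maps. -/
structure ExchLawC (D : CDS) where
  w : ∀ a : Finset ℕ, D.obj a → ℝ
  nonneg : ∀ (a : Finset ℕ) (x : D.obj a), 0 ≤ w a x
  total : ∀ a : Finset ℕ, ∑ x : D.obj a, w a x = 1
  push : ∀ {b a : Finset ℕ} (τ : ↥b ↪ ↥a) (y : D.obj b),
    ∑ x ∈ Finset.univ.filter (fun x : D.obj a => D.map τ x = y), w a x = w b y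

/-- The independence property for an exchangeable law on a combinatorial data
structure: measurements on disjoint sets are independent. -/
def indepPropertyC (D : CDS) (μ : ExchLawC D) : Prop :=
  ∀ (a b : Finset ℕ), Disjoint a b → ∀ (x : D.obj a) (y : D.obj b),
    ∑ z ∈ Finset.univ.filter (fun z : D.obj (a ∪ b) =>
        D.map (inclEmb Finset.subset_union_left) z = x ∧
        D.map (inclEmb Finset.subset_union_right) z = y), μ.w (a ∪ b) z
      = μ.w a x * μ.w b y

/-- The combinatorial density of a small structure `x ∈ D_b` inside a large one
`y ∈ D_a`: the probability that a uniformly random injection `τ : b ↪ a`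
satisfies `D[τ](y) = x`. -/
noncomputable def density (D : CDS) {b a : Finset ℕ} (x : D.obj b) (y : D.obj a) : ℝ :=
  ((Nat.factorial (a.card - b.card) : ℝ) / (Nat.factorial a.card : ℝ)) *
    ((Finset.univ.filter (fun τ : ↥b ↪ ↥a => D.map τ y = x)).card : ℝ)

open Filter Topology Finset

section Embeddings

variable {α β γ : Type*} [Fintype α] [Fintype β] [Fintype γ] [DecidableEq α]

/-- Any two embeddings into a finite type differ by a permutation of the target. -/
lemma Function.Embedding.exists_perm_trans_eq (ρ ρ' : β ↪ α) :
    ∃ g : Equiv.Perm α, ρ.trans g.toEmbedding = ρ' := by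
  let e : {x // x ∈ Set.range ρ} ≃ {x // x ∈ Set.range ρ'} :=
    (Equiv.ofInjective ρ ρ.injective).symm.trans (Equiv.ofInjective ρ' ρ'.injective)
  refine ⟨e.extendSubtype, ?_⟩
  ext i
  have h := e.extendSubtype_apply_of_mem (ρ i) ⟨i, rfl⟩
  have h2 : (Equiv.ofInjective ρ ρ.injective).symm ⟨ρ i, ⟨i, rfl⟩⟩ = i :=
    Equiv.ofInjective_symm_apply ρ.injective i
  simpa [e, h2] using h

lemma card_extensions_eq [DecidableEq β] (τ : β ↪ γ) (ρ ρ' : β ↪ α) :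
    #{σ : γ ↪ α | τ.trans σ = ρ} = #{σ : γ ↪ α | τ.trans σ = ρ'} := by
  obtain ⟨g, rfl⟩ := ρ.exists_perm_trans_eq ρ'
  refine Finset.card_bij' (fun σ _ => σ.trans g.toEmbedding)
    (fun σ _ => σ.trans g.symm.toEmbedding) ?_ ?_ ?_ ?_
  · intro σ hσ
    simp only [mem_filter, mem_univ, true_and] at hσ ⊢
    rw [← hσ]; rfl
  · intro σ hσ
    simp only [mem_filter, mem_univ, true_and] at hσ ⊢
    ext i
    have := DFunLike.congr_fun hσ i
    simp only [Function.Embedding.trans_apply, Equiv.coe_toEmbedding] at this ⊢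
    rw [this, Equiv.symm_apply_apply]
  · intro σ _; ext; simp
  · intro σ _; ext; simp

/-- Restricting a uniformly random embedding of `γ` along `τ : β ↪ γ` gives a uniformly random
embedding of `β`. -/
lemma average_restrict_embedding [DecidableEq β] [Nonempty (γ ↪ α)] (τ : β ↪ γ) (f : (β ↪ α) → ℝ) :
    (∑ σ : γ ↪ α, f (τ.trans σ)) / Fintype.card (γ ↪ α) =
      (∑ ρ : β ↪ α, f ρ) / Fintype.card (β ↪ α) := by
  obtain ⟨σ₀⟩ := ‹Nonempty (γ ↪ α)›
  set k := #{σ : γ ↪ α | τ.trans σ = τ.trans σ₀} with hk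
  have hk0 : 0 < k := Finset.card_pos.mpr ⟨σ₀, by simp⟩
  have key : ∀ f : (β ↪ α) → ℝ, ∑ σ : γ ↪ α, f (τ.trans σ) = k * ∑ ρ : β ↪ α, f ρ := by
    intro f
    rw [← Finset.sum_fiberwise univ (fun σ : γ ↪ α => τ.trans σ), Finset.mul_sum]
    refine Finset.sum_congr rfl fun ρ _ => ?_
    rw [Finset.sum_congr rfl (g := fun _ => f ρ) (by simp +contextual), Finset.sum_const,
      nsmul_eq_mul, hk, card_extensions_eq τ (τ.trans σ₀) ρ]
  have h1 := key fun _ => 1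
  simp only [sum_const, card_univ, nsmul_eq_mul, mul_one] at h1
  rw [key, h1, mul_div_mul_left]
  exact_mod_cast hk0.ne'

end Embeddings

/-- The averages of a `[0, 1]`-valued function over a finite type and over an injected part of it
differ by at most the proportion of the complement of that part. -/
lemma abs_average_comp_sub_average_le {ι κ : Type*} [Fintype ι] [Fintype κ] [Nonempty ι]
    [DecidableEq κ] (g : ι → κ) (hg : Function.Injective g) (h : κ → ℝ)
    (h0 : ∀ k, 0 ≤ h k) (h1 : ∀ k, h k ≤ 1) :
    |(∑ i, h (g i)) / Fintype.card ι - (∑ k, h k) / Fintype.card κ| ≤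
      1 - (Fintype.card ι : ℝ) / Fintype.card κ := by
  have hι : (0 : ℝ) < Fintype.card ι := by exact_mod_cast Fintype.card_pos
  have hle : (Fintype.card ι : ℝ) ≤ Fintype.card κ := by
    exact_mod_cast Fintype.card_le_of_injective g hg
  have hκ := hι.trans_le hle
  have himg : ∀ f : κ → ℝ, ∑ i, f (g i) = ∑ k ∈ univ.image g, f k := fun f =>
    (Finset.sum_image fun _ _ _ _ e => hg e).symm
  have hsplit : ∀ f : κ → ℝ, ∑ k, f k = ∑ i, f (g i) + ∑ k ∈ (univ.image g)ᶜ, f k := fun f => by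
    rw [himg, Finset.sum_add_sum_compl]
  have hS0 : 0 ≤ ∑ i, h (g i) := Finset.sum_nonneg fun _ _ => h0 _
  have hS1 : ∑ i, h (g i) ≤ Fintype.card ι := by
    simpa using Finset.sum_le_sum fun i (_ : i ∈ univ) => h1 (g i)
  have hC0 : 0 ≤ ∑ k ∈ (univ.image g)ᶜ, h k := Finset.sum_nonneg fun _ _ => h0 _
  have hC1 : ∑ k ∈ (univ.image g)ᶜ, h k ≤ Fintype.card κ - Fintype.card ι := by
    have e := hsplit fun _ => 1
    have := Finset.sum_le_sum fun k (_ : k ∈ (univ.image g)ᶜ) => h1 k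
    simp only [sum_const, card_univ, nsmul_eq_mul, mul_one] at e this
    linarith
  rw [hsplit h]
  generalize (∑ i, h (g i)) = S at *
  generalize (∑ k ∈ (univ.image g)ᶜ, h k) = C at *
  generalize (Fintype.card ι : ℝ) = m at *
  generalize (Fintype.card κ : ℝ) = M at *
  have e1 : 1 - m / M = (M - m) / M := by field_simp
  have hSm : S / m ≤ 1 := (div_le_one hι).2 hS1
  have hSm0 : 0 ≤ S / m := div_nonneg hS0 hι.le
  have e2 : S / m - (S + C) / M = (S / m * (M - m) - C) / M := by field_simp; ring
  rw [e1, e2, abs_div, abs_of_pos hκ]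
  gcongr
  rw [abs_le]
  constructor <;> nlinarith [mul_nonneg hSm0 (sub_nonneg.2 hle),
    mul_nonneg (sub_nonneg.2 hSm) (sub_nonneg.2 hle)]

lemma tendsto_descFactorial_div_pow (k : ℕ) :
    Tendsto (fun n : ℕ => (n.descFactorial k : ℝ) / (n : ℝ) ^ k) atTop (𝓝 1) := by
  exact (Asymptotics.isEquivalent_iff_tendsto_one (by
    filter_upwards [eventually_gt_atTop 0] with n hn; positivity)).1 (isEquivalent_descFactorial k)

/-- Two independent uniformly random embeddings into a large set have disjoint ranges with
probability close to one. -/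
lemma tendsto_descFactorial_collision (k l : ℕ) :
    Tendsto (fun n : ℕ => 1 - (n.descFactorial (k + l) : ℝ) /
      (n.descFactorial k * n.descFactorial l)) atTop (𝓝 0) := by
  have h := (tendsto_descFactorial_div_pow (k + l)).div
    ((tendsto_descFactorial_div_pow k).mul (tendsto_descFactorial_div_pow l)) (by norm_num)
  have h' := h.const_sub 1
  norm_num at h'
  refine h'.congr' ?_
  filter_upwards [eventually_gt_atTop 0] with n hn
  have : (n : ℝ) ≠ 0 := by positivity
  rw [div_mul_div_comm, ← pow_add, div_div_div_cancel_right₀ (by positivity)]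

section Density

variable {D : CDS}

lemma density_eq_average {b a : Finset ℕ} (h : #b ≤ #a) (x : D.obj b) (y : D.obj a) :
    density D x y =
      (∑ τ : ↥b ↪ ↥a, if D.map τ y = x then (1 : ℝ) else 0) / Fintype.card (↥b ↪ ↥a) := by
  have hf : ((#a - #b).factorial : ℝ) ≠ 0 := by positivity
  rw [density, Finset.sum_boole, Fintype.card_embedding_eq, Fintype.card_coe, Fintype.card_coe,
    ← Nat.factorial_mul_descFactorial h, Nat.cast_mul, ← div_div, div_self hf]
  ring

lemma density_nonneg {b a : Finset ℕ} (x : D.obj b) (y : D.obj a) : 0 ≤ density D x y := by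
  unfold density; positivity

lemma nonempty_embedding_of_card_le {b a : Finset ℕ} (h : #b ≤ #a) : Nonempty (↥b ↪ ↥a) :=
  Function.Embedding.nonempty_of_card_le (by simpa using h)

lemma sum_density_mul {b a : Finset ℕ} (h : #b ≤ #a) (f : D.obj b → ℝ) (y : D.obj a) :
    ∑ x, f x * density D x y =
      (∑ τ : ↥b ↪ ↥a, f (D.map τ y)) / Fintype.card (↥b ↪ ↥a) := by
  simp_rw [density_eq_average h, mul_div_assoc', Finset.mul_sum]
  rw [← Finset.sum_div, Finset.sum_comm]
  simp

lemma sum_density {b a : Finset ℕ} (h : #b ≤ #a) (y : D.obj a) :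
    ∑ x : D.obj b, density D x y = 1 := by
  have := nonempty_embedding_of_card_le h
  have hc : (Fintype.card (↥b ↪ ↥a) : ℝ) ≠ 0 := by exact_mod_cast Fintype.card_ne_zero
  have := sum_density_mul h (fun _ => 1) y
  simp only [one_mul, sum_const, card_univ, nsmul_eq_mul, mul_one] at this
  rw [this, div_self hc]

lemma sum_filter_density {b a : Finset ℕ} (h : #b ≤ #a) (p : D.obj b → Prop) [DecidablePred p]
    (y : D.obj a) :
    ∑ x with p x, density D x y =
      (∑ τ : ↥b ↪ ↥a, if p (D.map τ y) then (1 : ℝ) else 0) / Fintype.card (↥b ↪ ↥a) := by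
  rw [← sum_density_mul h (fun x => if p x then (1 : ℝ) else 0), Finset.sum_filter]
  simp

lemma sum_density_map_eq {b c a : Finset ℕ} (h : #c ≤ #a) (τ : ↥b ↪ ↥c) (x : D.obj b)
    (y : D.obj a) : ∑ z with D.map τ z = x, density D z y = density D x y := by
  have := nonempty_embedding_of_card_le h
  have hbc : #b ≤ #c := by simpa using Fintype.card_le_of_embedding τ
  rw [sum_filter_density h, density_eq_average (hbc.trans h),
    ← average_restrict_embedding τ fun ρ => if D.map ρ y = x then (1 : ℝ) else 0]
  simp [D.map_comp]

lemma map_symm_map {b c : Finset ℕ} (e : ↥b ≃ ↥c) (z : D.obj c) :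
    D.map e.symm.toEmbedding (D.map e.toEmbedding z) = z := by
  have h := congrFun (D.map_comp e.symm.toEmbedding e.toEmbedding) z
  rw [show e.symm.toEmbedding.trans e.toEmbedding = Function.Embedding.refl _ by ext; simp,
    D.map_id] at h
  exact h.symm

lemma filter_map_equiv_eq_singleton {b c : Finset ℕ} (e : ↥b ≃ ↥c) (v : D.obj b) :
    ({z | D.map e.toEmbedding z = v} : Finset (D.obj c)) = {D.map e.symm.toEmbedding v} := by
  ext z
  simp only [mem_filter, mem_univ, true_and, mem_singleton]
  constructor
  · rintro rfl; exact (map_symm_map e z).symm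
  · rintro rfl; exact map_symm_map e.symm v

lemma density_map_equiv {b c a : Finset ℕ} (e : ↥b ≃ ↥c) (h : #c ≤ #a) (v : D.obj b)
    (y : D.obj a) : density D (D.map e.symm.toEmbedding v) y = density D v y := by
  rw [← sum_density_map_eq h e.toEmbedding v y, filter_map_equiv_eq_singleton, sum_singleton]

lemma ExchLawC.w_map_equiv (μ : ExchLawC D) {b c : Finset ℕ} (e : ↥b ≃ ↥c) (v : D.obj b) :
    μ.w c (D.map e.symm.toEmbedding v) = μ.w b v := by
  rw [← μ.push e.toEmbedding v, filter_map_equiv_eq_singleton, sum_singleton]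

/-- Under an exchangeable law, the expected density of `v` is its probability. -/
lemma ExchLawC.sum_w_mul_density (μ : ExchLawC D) {b a : Finset ℕ} (h : #b ≤ #a) (v : D.obj b) :
    ∑ y, μ.w a y * density D v y = μ.w b v := by
  have := nonempty_embedding_of_card_le h
  have hc : (Fintype.card (↥b ↪ ↥a) : ℝ) ≠ 0 := by exact_mod_cast Fintype.card_ne_zero
  simp_rw [density_eq_average h, mul_div_assoc', Finset.mul_sum]
  rw [← Finset.sum_div, Finset.sum_comm, div_eq_iff hc]
  simp_rw [mul_ite, mul_one, mul_zero, ← Finset.sum_filter, μ.push]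
  simp [mul_comm]

/-- The proportion of pairs of embeddings of disjoint sets of sizes `k` and `l` into a set of
size `n` whose ranges meet. -/
noncomputable def collisionRate (k l n : ℕ) : ℝ :=
  1 - (n.descFactorial (k + l) : ℝ) / (n.descFactorial k * n.descFactorial l)

/-- The joint density of two structures on disjoint sets is nearly the product of their
densities. -/
lemma abs_joint_density_sub_mul_le {b c a : Finset ℕ} (hd : Disjoint b c) (h : #b + #c ≤ #a)
    (x : D.obj b) (x' : D.obj c) (y : D.obj a) :
    |∑ z : D.obj (b ∪ c) with D.map (inclEmb subset_union_left) z = x ∧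
        D.map (inclEmb subset_union_right) z = x', density D z y -
      density D x y * density D x' y| ≤ collisionRate #b #c #a := by
  have hu : #(b ∪ c) = #b + #c := card_union_of_disjoint hd
  have hne : Nonempty (↥(b ∪ c) ↪ ↥a) := nonempty_embedding_of_card_le (hu.trans_le h)
  let g : (↥(b ∪ c) ↪ ↥a) → (↥b ↪ ↥a) × (↥c ↪ ↥a) := fun σ =>
    ((inclEmb subset_union_left).trans σ, (inclEmb subset_union_right).trans σ)
  have hg : Function.Injective g := by
    intro σ σ' e
    ext ⟨i, hi⟩
    obtain ⟨e1, e2⟩ := Prod.ext_iff.1 e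
    rcases mem_union.1 hi with hi | hi
    · exact congrArg Subtype.val (DFunLike.congr_fun e1 ⟨i, hi⟩)
    · exact congrArg Subtype.val (DFunLike.congr_fun e2 ⟨i, hi⟩)
  have key := abs_average_comp_sub_average_le g hg
    (fun p => (if D.map p.1 y = x then (1 : ℝ) else 0) * if D.map p.2 y = x' then (1 : ℝ) else 0)
    (fun p => by split_ifs <;> norm_num) (fun p => by split_ifs <;> norm_num)
  rw [Fintype.card_prod, Fintype.sum_prod_type] at key
  rw [← Finset.sum_mul_sum univ univ (fun τ : ↥b ↪ ↥a => if D.map τ y = x then (1 : ℝ) else 0)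
    fun τ : ↥c ↪ ↥a => if D.map τ y = x' then (1 : ℝ) else 0, Nat.cast_mul, mul_div_mul_comm, ← density_eq_average (by lia),
    ← density_eq_average (by lia)] at key
  rw [sum_filter_density (by lia)]
  refine le_of_eq_of_le ?_ (key.trans_eq ?_)
  · simp [g, D.map_comp, ite_and, -mul_ite, ite_mul]
  · simp [collisionRate, hu]

lemma tendsto_collisionRate (k l : ℕ) : Tendsto (collisionRate k l) atTop (𝓝 0) :=
  tendsto_descFactorial_collision k l

/-- An exchangeable law with the independence property gives each density a small variance in
a large structure. -/
lemma ExchLawC.variance_density_le (μ : ExchLawC D) (hμ : indepPropertyC D μ) {b a : Finset ℕ}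
    (h : #b + #b ≤ #a) (v : D.obj b) :
    ∑ y, μ.w a y * (density D v y - μ.w b v) ^ 2 ≤ collisionRate #b #b #a := by
  obtain ⟨c, hcb, hc⟩ := (Set.Finite.infinite_compl b.finite_toSet).exists_subset_card_eq #b
  have hd : Disjoint b c := Finset.disjoint_right.2 fun i hi => by simpa using hcb hi
  let e : ↥b ≃ ↥c := Finset.equivOfCardEq hc.symm
  have hu : #(b ∪ c) = #b + #c := card_union_of_disjoint hd
  have h2 : ∑ y, μ.w a y * density D v y ^ 2 ≤ μ.w b v ^ 2 + collisionRate #b #b #a := by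
    have hp : ∀ y : D.obj a, density D v y ^ 2 ≤
        ∑ z : D.obj (b ∪ c) with D.map (inclEmb subset_union_left) z = v ∧
          D.map (inclEmb subset_union_right) z = D.map e.symm.toEmbedding v, density D z y +
        collisionRate #b #b #a := fun y => by
      have := (abs_le.1 (abs_joint_density_sub_mul_le hd (by lia) v
        (D.map e.symm.toEmbedding v) y)).1
      rw [density_map_equiv e (by lia), hc] at this
      linarith
    calc ∑ y, μ.w a y * density D v y ^ 2
        ≤ ∑ y, μ.w a y * _ :=
          Finset.sum_le_sum fun y _ => mul_le_mul_of_nonneg_left (hp y) (μ.nonneg a y)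
      _ = _ := by
          simp_rw [mul_add, Finset.sum_add_distrib, ← Finset.sum_mul, μ.total, one_mul,
            Finset.mul_sum]
          rw [Finset.sum_comm]
          simp_rw [μ.sum_w_mul_density (show #(b ∪ c) ≤ #a by lia)]
          rw [hμ b c hd, μ.w_map_equiv e, sq]
  have h1 := μ.sum_w_mul_density (show #b ≤ #a by lia) v
  have h0 := μ.total a
  have : ∑ y, μ.w a y * (density D v y - μ.w b v) ^ 2 =
      ∑ y, μ.w a y * density D v y ^ 2 - 2 * μ.w b v * (∑ y, μ.w a y * density D v y) +
        μ.w b v ^ 2 * ∑ y, μ.w a y := by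
    simp_rw [Finset.mul_sum, ← Finset.sum_sub_distrib, ← Finset.sum_add_distrib]
    exact Finset.sum_congr rfl fun y _ => by ring
  rw [this, h1, h0]
  linarith

/-- A value at most the mean is attained. -/
lemma ExchLawC.exists_le_mean (μ : ExchLawC D) (a : Finset ℕ) (f : D.obj a → ℝ) :
    ∃ y, f y ≤ ∑ y, μ.w a y * f y := by
  obtain ⟨y₀⟩ := D.nonempty a
  obtain ⟨y, -, hy⟩ := Finset.exists_min_image univ f ⟨y₀, mem_univ _⟩
  refine ⟨y, ?_⟩
  calc f y = ∑ z, μ.w a z * f y := by rw [← Finset.sum_mul, μ.total, one_mul]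
    _ ≤ _ := Finset.sum_le_sum fun z hz => mul_le_mul_of_nonneg_left (hy z hz) (μ.nonneg a z)

/-- The limit densities of a convergent sequence of structures form an exchangeable law. -/
def limitLaw (A : ℕ → Finset ℕ) (x : ∀ n, D.obj (A n))
    (hA : Tendsto (fun n => #(A n)) atTop atTop) (w : ∀ b, D.obj b → ℝ)
    (hw : ∀ b v, Tendsto (fun n => density D v (x n)) atTop (𝓝 (w b v))) : ExchLawC D where
  w := w
  nonneg b v := ge_of_tendsto' (hw b v) fun _ => density_nonneg _ _
  total b := by
    refine tendsto_nhds_unique (tendsto_finsetSum univ fun v _ => hw b v) ?_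
    refine tendsto_const_nhds.congr' ?_
    filter_upwards [hA.eventually_ge_atTop #b] with n hn
    exact (sum_density hn _).symm
  push {b c} τ y := by
    refine tendsto_nhds_unique (tendsto_finsetSum _ fun v _ => hw c v) ((hw b y).congr' ?_)
    filter_upwards [hA.eventually_ge_atTop #c] with n hn
    exact (sum_density_map_eq hn τ y _).symm

lemma indepPropertyC_of_tendsto_density (A : ℕ → Finset ℕ) (x : ∀ n, D.obj (A n))
    (hA : Tendsto (fun n => #(A n)) atTop atTop) (μ : ExchLawC D)
    (hμ : ∀ b v, Tendsto (fun n => density D v (x n)) atTop (𝓝 (μ.w b v))) :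
    indepPropertyC D μ := by
  intro b c hd v v'
  have h1 := (tendsto_finsetSum (univ.filter fun z : D.obj (b ∪ c) =>
    D.map (inclEmb subset_union_left) z = v ∧ D.map (inclEmb subset_union_right) z = v')
    fun z _ => hμ (b ∪ c) z).sub ((hμ b v).mul (hμ c v'))
  have h2 : Tendsto (fun n => collisionRate #b #c #(A n)) atTop (𝓝 0) :=
    (tendsto_collisionRate #b #c).comp hA
  refine sub_eq_zero.1 (tendsto_nhds_unique h1 (squeeze_zero_norm' ?_ h2))
  filter_upwards [hA.eventually_ge_atTop (#b + #c)] with n hn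
  exact abs_joint_density_sub_mul_le hd hn v v' (x n)

lemma ExchLawC.ext_w {μ ν : ExchLawC D} (h : ∀ b v, μ.w b v = ν.w b v) : μ = ν := by
  have : μ.w = ν.w := by ext b v; exact h b v
  cases μ; cases ν; congr

/-- Finitely many densities can be approximated simultaneously in a large structure. -/
lemma ExchLawC.eventually_exists_density_near (μ : ExchLawC D) (hμ : indepPropertyC D μ)
    (s : Finset (Σ b, D.obj b)) {ε : ℝ} (hε : 0 < ε) :
    ∀ᶠ n in atTop, ∃ y : D.obj (range n), ∀ i ∈ s, |density D i.2 y - μ.w i.1 i.2| < ε := by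
  have hlim : Tendsto (fun n => ∑ i ∈ s, collisionRate #i.1 #i.1 n) atTop (𝓝 0) := by
    simpa using tendsto_finsetSum s fun i _ => tendsto_collisionRate #i.1 #i.1
  filter_upwards [hlim.eventually_lt_const (pow_pos hε 2),
    (s.eventually_all).2 fun i _ => eventually_ge_atTop (#i.1 + #i.1)] with n hn hs
  obtain ⟨y, hy⟩ := μ.exists_le_mean (range n)
    fun y => ∑ i ∈ s, (density D i.2 y - μ.w i.1 i.2) ^ 2
  refine ⟨y, fun i hi => abs_lt_of_sq_lt_sq ?_ hε.le⟩
  calc (density D i.2 y - μ.w i.1 i.2) ^ 2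
      ≤ ∑ i ∈ s, (density D i.2 y - μ.w i.1 i.2) ^ 2 :=
        Finset.single_le_sum (f := fun i : Σ b, D.obj b => (density D i.2 y - μ.w i.1 i.2) ^ 2)
          (fun _ _ => sq_nonneg _) hi
    _ ≤ ∑ i ∈ s, ∑ y, μ.w (range n) y * (density D i.2 y - μ.w i.1 i.2) ^ 2 := by
        rw [Finset.sum_comm]; simpa only [Finset.mul_sum] using hy
    _ ≤ ∑ i ∈ s, collisionRate #i.1 #i.1 n := Finset.sum_le_sum fun i hi => by
        simpa using μ.variance_density_le hμ (a := range n) (by simpa using hs i hi) i.2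
    _ < ε ^ 2 := hn

lemma ExchLawC.exists_tendsto_density (μ : ExchLawC D) (hμ : indepPropertyC D μ) :
    ∃ (A : ℕ → Finset ℕ) (x : ∀ n, D.obj (A n)), Tendsto (fun n => #(A n)) atTop atTop ∧
      ∀ b (v : D.obj b), Tendsto (fun n => density D v (x n)) atTop (𝓝 (μ.w b v)) := by
  obtain ⟨f, hf⟩ := exists_injective_nat (Σ b, D.obj b)
  have hfin : ∀ m, (f ⁻¹' Set.Iic m).Finite := fun m =>
    (Set.finite_Iic m).preimage hf.injOn
  have H : ∀ m : ℕ, ∃ n, m ≤ n ∧ ∃ y : D.obj (range n), ∀ i ∈ (hfin m).toFinset,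
      |density D i.2 y - μ.w i.1 i.2| < 1 / ((m : ℝ) + 1) := fun m =>
    ((eventually_ge_atTop m).and
      (μ.eventually_exists_density_near hμ (hfin m).toFinset (by positivity))).exists
  choose N hN y hy using H
  refine ⟨fun m => range (N m), y, ?_, fun b v => ?_⟩
  · simpa using tendsto_atTop_mono hN tendsto_id
  · rw [← tendsto_sub_nhds_zero_iff]
    refine squeeze_zero_norm' ?_ tendsto_one_div_add_atTop_nhds_zero_nat
    filter_upwards [eventually_ge_atTop (f ⟨b, v⟩)] with m hm
    exact (hy m ⟨b, v⟩ (by simpa using hm)).le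

end Density

/-- Correspondence between limits of combinatorial structures and ergodic
exchangeable laws: every convergent sequence has as its limit densities exactly one
exchangeable law with the independence property, and every such law arises as the
limit of a convergent sequence. -/
theorem limits_correspond_to_ergodic_exchangeable_laws (D : CDS) :
    (∀ (A : ℕ → Finset ℕ) (x : ∀ n : ℕ, D.obj (A n)),
      Filter.Tendsto (fun n => (A n).card) Filter.atTop Filter.atTop →
      (∀ (b : Finset ℕ) (v : D.obj b), ∃ Lv : ℝ,
        Filter.Tendsto (fun n => density D v (x n)) Filter.atTop (nhds Lv)) →
      ∃! μ : ExchLawC D, indepPropertyC D μ ∧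
        ∀ (b : Finset ℕ) (v : D.obj b),
          Filter.Tendsto (fun n => density D v (x n)) Filter.atTop (nhds (μ.w b v))) ∧
    (∀ μ : ExchLawC D, indepPropertyC D μ →
      ∃ (A : ℕ → Finset ℕ) (x : ∀ n : ℕ, D.obj (A n)),
        Filter.Tendsto (fun n => (A n).card) Filter.atTop Filter.atTop ∧
        ∀ (b : Finset ℕ) (v : D.obj b),
          Filter.Tendsto (fun n => density D v (x n)) Filter.atTop (nhds (μ.w b v))) := by
  refine ⟨fun A x hA hx => ?_, fun μ hμ => μ.exists_tendsto_density hμ⟩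
  choose w hw using hx
  refine ⟨limitLaw A x hA w hw, ⟨indepPropertyC_of_tendsto_density A x hA _ hw, hw⟩, ?_⟩
  rintro ν ⟨-, hν⟩
  exact ExchLawC.ext_w fun b v => tendsto_nhds_unique (hν b v) (hw b v)
end
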